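/- arXiv:1706.09029 — 2 statements merged into one kernel-verified Lean document; each statement's English description precedes it below -/
import Mathlib

section
/- Every 3-tough 2K2-free graph on at least three vertices is Hamiltonian. -/
open SimpleGraph

variable {V : Type*}

/-- `G` has no induced `2K₂`. -/
def TwoK2Free (G : SimpleGraph V) : Prop :=
  ¬ ∃ a b c d : V, a ≠ b ∧ a ≠ c ∧ a ≠ d ∧ b ≠ c ∧ b ≠ d ∧ c ≠ d ∧
      G.Adj a b ∧ G.Adj c d ∧ ¬G.Adj a c ∧ ¬G.Adj a d ∧ ¬G.Adj b c ∧ ¬G.Adj b d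

/-- An independent set of vertices. -/
def IndepSet (G : SimpleGraph V) (s : Set V) : Prop :=
  s.Pairwise fun a b => ¬ G.Adj a b

/-- Number of connected components of `G - S`. -/
noncomputable def compCount [Fintype V] (G : SimpleGraph V) (S : Set V) : ℕ :=
  Nat.card ((G.induce Sᶜ).ConnectedComponent)

/-- `G` is `t`-tough. -/
def Tough [Fintype V] (t : ℝ) (G : SimpleGraph V) : Prop :=
  ∀ S : Set V, 2 ≤ compCount G S → t * (compCount G S : ℝ) ≤ (S.ncard : ℝ)

/-- A family of `k` pairwise vertex-disjoint cycles in `G` covering all vertices,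
i.e. the cycles of a 2-factor of `G`. -/
structure CycleFamily (G : SimpleGraph V) (k : ℕ) (n : Fin k → ℕ)
    (c : ∀ i : Fin k, ZMod (n i) → V) : Prop where
  three_le : ∀ i, 3 ≤ n i
  inj : ∀ i, Function.Injective (c i)
  adj : ∀ i j, G.Adj (c i j) (c i (j + 1))
  disj : ∀ i i' j j', c i j = c i' j' → i = i'
  spanning : ∀ v, ∃ i j, c i j = v

/-- A vertex `v` lying on cycle `i` of the family is of A-type if it is adjacent to two
consecutive vertices of some other cycle of the family. -/
def AType {k : ℕ} {n : Fin k → ℕ} (G : SimpleGraph V)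
    (c : ∀ i : Fin k, ZMod (n i) → V) (i : Fin k) (v : V) : Prop :=
  ∃ i' : Fin k, i' ≠ i ∧ ∃ j : ZMod (n i'), G.Adj v (c i' j) ∧ G.Adj v (c i' (j + 1))




theorem comp_ge [Fintype V] (G : SimpleGraph V) (S : Set V) (I : Finset V)
    (hS : ∀ v ∈ I, v ∉ S)
    (hiso : ∀ u ∈ I, ∀ v ∈ I, u ≠ v →
      (∀ w, G.Adj u w → w ∈ S) ∨ (∀ w, G.Adj v w → w ∈ S)) :
    I.card ≤ compCount G S := by
  classical
  have key : ∀ u v : (Sᶜ : Set V), u ≠ v → (∀ w, G.Adj u w → w ∈ S) →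
      ¬ (G.induce Sᶜ).Reachable u v := by
    intro u v huv h hr
    obtain ⟨p⟩ := hr
    cases p with
    | nil => exact huv rfl
    | cons hadj q =>
      rename_i w
      exact w.2 (h w hadj)
  unfold compCount
  have : I.card = Nat.card I := by simp
  rw [this]
  apply Nat.card_le_card_of_injective
    (fun v : I => (G.induce Sᶜ).connectedComponentMk ⟨v.1, hS v.1 v.2⟩)
  intro u v huv
  by_contra hne
  have hne' : u.1 ≠ v.1 := fun h => hne (Subtype.ext h)
  have hr := SimpleGraph.ConnectedComponent.exact huv
  rcases hiso u.1 u.2 v.1 v.2 hne' with h | h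
  · exact key _ _ (fun h => hne' (Subtype.mk.inj h)) h hr
  · exact key _ _ (fun h => hne' (Subtype.mk.inj h).symm) h hr.symm

open Classical in
/-- The neighbourhood of a finite set of vertices. -/
noncomputable def nbr [Fintype V] (G : SimpleGraph V) (I : Finset V) : Finset V :=
  Finset.univ.filter (fun w => ∃ v ∈ I, G.Adj v w)

theorem mem_nbr [Fintype V] {G : SimpleGraph V} {I : Finset V} {w : V} :
    w ∈ nbr G I ↔ ∃ v ∈ I, G.Adj v w := by
  simp [nbr]

theorem tough_comp [Fintype V] {G : SimpleGraph V} (ht : Tough 3 G) (S : Finset V) (k : ℕ)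
    (hk : 2 ≤ k) (h : k ≤ compCount G (S : Set V)) : 3 * k ≤ S.card := by
  have h1 := ht (S : Set V) (hk.trans h)
  rw [Set.ncard_coe_finset] at h1
  have h2 : 3 * compCount G (S : Set V) ≤ S.card := by exact_mod_cast h1
  omega

theorem tough_indep [Fintype V] {G : SimpleGraph V} (ht : Tough 3 G) (I : Finset V)
    (hI : ∀ u ∈ I, ∀ v ∈ I, ¬ G.Adj u v) (h2 : 2 ≤ I.card) :
    3 * I.card ≤ (nbr G I).card := by
  apply tough_comp ht _ _ h2
  apply comp_ge
  · intro v hv hv'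
    obtain ⟨u, hu, huv⟩ := mem_nbr.1 (Finset.mem_coe.1 hv')
    exact hI u hu v hv huv
  · intro u hu v hv _
    exact Or.inl fun w hw => Finset.mem_coe.2 (mem_nbr.2 ⟨u, hu, hw⟩)

theorem indep_four [Fintype V] {G : SimpleGraph V} (ht : Tough 3 G) (I : Finset V)
    (hI : ∀ u ∈ I, ∀ v ∈ I, ¬ G.Adj u v) (h4 : 4 ≤ Fintype.card V) :
    4 * I.card ≤ Fintype.card V := by
  classical
  by_cases h2 : 2 ≤ I.card
  · have h := tough_indep ht I hI h2
    have hd : Disjoint I (nbr G I) := by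
      rw [Finset.disjoint_left]
      intro v hv hv'
      obtain ⟨u, hu, huv⟩ := mem_nbr.1 hv'
      exact hI u hu v hv huv
    have := Finset.card_union_of_disjoint hd
    have h3 := Finset.card_le_univ (I ∪ nbr G I)
    omega
  · omega

theorem tough_deg [Fintype V] {G : SimpleGraph V} (ht : Tough 3 G) (v w : V) (hvw : v ≠ w)
    (hn : ¬ G.Adj v w) : 6 ≤ (nbr G {v}).card := by
  classical
  have := tough_comp ht (nbr G {v}) 2 le_rfl ?_
  · omega
  have h2 : ({v, w} : Finset V).card = 2 := Finset.card_pair hvw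
  rw [← h2]
  apply comp_ge
  · intro u hu hu'
    have hu' := mem_nbr.1 (Finset.mem_coe.1 hu')
    simp at hu hu'
    rcases hu with rfl | rfl
    · exact G.loopless.irrefl _ hu'
    · exact hn hu'
  · have hv : ∀ u, G.Adj v u → u ∈ ((nbr G {v} : Finset V) : Set V) := by
      intro u hu
      exact Finset.mem_coe.2 (mem_nbr.2 ⟨v, by simp, hu⟩)
    intro a ha b hb hab
    simp at ha hb
    rcases ha with rfl | rfl
    · exact Or.inl hv
    · rcases hb with rfl | rfl
      · exact Or.inr hv
      · exact absurd rfl hab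

theorem tough_T [Fintype V] {G : SimpleGraph V} (ht : Tough 3 G) (I : Finset V)
    (hI : ∀ u ∈ I, ∀ v ∈ I, ¬ G.Adj u v) (hne : I.Nonempty) (h4 : 4 ≤ Fintype.card V) :
    2 * I.card + 1 ≤ (nbr G I).card := by
  classical
  by_cases h2 : 2 ≤ I.card
  · have := tough_indep ht I hI h2
    omega
  · have h1 : I.card = 1 := by
      have := hne.card_pos
      omega
    obtain ⟨v, rfl⟩ := Finset.card_eq_one.1 h1
    by_cases hw : ∃ w, v ≠ w ∧ ¬ G.Adj v w
    · obtain ⟨w, hvw, hn⟩ := hw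
      have := tough_deg ht v w hvw hn
      omega
    · push Not at hw
      have : Finset.univ.erase v ⊆ nbr G {v} := by
        intro w hw'
        rw [mem_nbr]
        exact ⟨v, by simp, hw w (Finset.ne_of_mem_erase hw').symm⟩
      have := Finset.card_le_card this
      rw [Finset.card_erase_of_mem (Finset.mem_univ _), Finset.card_univ] at this
      omega

/-- `f` is a perfect matching (as an involution) on `D`. -/
def PMf (G : SimpleGraph V) (D : Finset V) (f : V → V) : Prop :=
  ∀ v ∈ D, f v ∈ D ∧ f (f v) = v ∧ G.Adj v (f v)

theorem twoK2 {G : SimpleGraph V} (hf : TwoK2Free G) {a b c d : V} (hab : G.Adj a b)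
    (hcd : G.Adj c d) (h1 : a ≠ c) (h2 : a ≠ d) (h3 : b ≠ c) (h4 : b ≠ d) :
    G.Adj a c ∨ G.Adj a d ∨ G.Adj b c ∨ G.Adj b d := by
  by_contra h
  push Not at h
  exact hf ⟨a, b, c, d, hab.ne, h1, h2, h3, h4, hcd.ne, hab, hcd, h.1, h.2.1, h.2.2.1, h.2.2.2⟩


theorem pm_exists [Fintype V] {G : SimpleGraph V} (ht : Tough 3 G) (S D : Finset V)
    (hSD : ∀ v, v ∈ D ↔ v ∉ S)
    (hS : S.card ≤ 5) (hev : Even D.card) : ∃ f, PMf G D f := by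
  classical
  let H := G.induce (D : Set V)
  have hex : ∃ M : Subgraph H, M.IsPerfectMatching := by
    rw [SimpleGraph.tutte]
    intro u hu
    unfold SimpleGraph.IsTutteViolator at hu
    let K := ((⊤ : H.Subgraph).deleteVerts u).coe
    let U : Finset V := S ∪ (u.toFinset.map (Function.Embedding.subtype _))
    have hUmem : ∀ v, v ∈ U ↔ v ∈ S ∨ ∃ h : v ∈ (D : Set V), (⟨v, h⟩ : (D : Set V)) ∈ u := by
      intro v
      simp [U]
    have hUc : U.card ≤ S.card + u.ncard := by
      refine (Finset.card_union_le _ _).trans ?_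
      rw [Finset.card_map, Set.ncard_eq_toFinset_card']
    have hpar := SimpleGraph.odd_ncard_oddComponents K
    have hcardK : Nat.card ((⊤ : H.Subgraph).deleteVerts u).verts + u.ncard = D.card := by
      have h1 : ((⊤ : H.Subgraph).deleteVerts u).verts = uᶜ := by
        ext x; simp
      rw [h1]
      have h2 := Set.ncard_add_ncard_compl u
      rw [Nat.card_coe_set_eq]
      have h3 : Nat.card (D : Set V) = D.card := by simp
      omega
    have hodd : u.ncard + 2 ≤ K.oddComponents.ncard := by
      have hu' : u.ncard < K.oddComponents.ncard := hu
      by_contra hlt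
      have : K.oddComponents.ncard = u.ncard + 1 := by omega
      rw [this] at hpar
      rw [← hcardK] at hev
      rcases Nat.even_or_odd u.ncard with h | h
      · have h1 := hpar.1 h.add_one
        have := Odd.add_even h1 h
        exact (Nat.not_even_iff_odd.2 this) hev
      · have h1 : ¬ Odd (u.ncard + 1) := by
          rw [Nat.not_odd_iff_even]
          exact h.add_one
        rw [hpar, Nat.not_odd_iff_even] at h1
        exact (Nat.not_even_iff_odd.2 (Even.add_odd h1 h)) hev
    let e : G.induce ((U : Set V)ᶜ) →g K :=
      { toFun := fun v => ⟨⟨v.1, by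
          have := v.2
          simp only [Set.mem_compl_iff, Finset.mem_coe, hUmem, not_or] at this
          exact Finset.mem_coe.2 ((hSD _).2 this.1)⟩, by
          have := v.2
          simp only [Set.mem_compl_iff, Finset.mem_coe, hUmem, not_or, not_exists] at this
          simp only [Subgraph.induce_verts, Subgraph.verts_top, Set.mem_sdiff, Set.mem_univ, true_and]
          exact this.2 ((hSD _).2 this.1)⟩
        map_rel' := by
          rintro a b hab
          have h1 := a.2
          have h2 := b.2
          simp only [Set.mem_compl_iff, Finset.mem_coe, hUmem, not_or, not_exists] at h1 h2
          simp only [K, Subgraph.coe_adj, Subgraph.deleteVerts_adj, Subgraph.verts_top, Set.mem_univ,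
            true_and, Subgraph.top_adj]
          exact ⟨h1.2 ((hSD _).2 h1.1), h2.2 ((hSD _).2 h2.1), hab⟩ }
    have hsurj : Function.Surjective e := by
      rintro ⟨⟨x, hx⟩, hxu⟩
      refine ⟨⟨x, ?_⟩, rfl⟩
      simp only [Set.mem_compl_iff, Finset.mem_coe, hUmem, not_or, not_exists]
      refine ⟨(hSD _).1 (Finset.mem_coe.1 hx), fun _ => ?_⟩
      simpa using hxu
    have hcomp : K.oddComponents.ncard ≤ compCount G (U : Set V) := by
      refine (Set.ncard_le_card _).trans ?_
      unfold compCount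
      apply Nat.card_le_card_of_surjective (ConnectedComponent.map e)
      intro c
      induction c using ConnectedComponent.ind with
      | h x =>
        obtain ⟨y, rfl⟩ := hsurj x
        exact ⟨(G.induce ((U : Set V)ᶜ)).connectedComponentMk y, rfl⟩
    have := tough_comp ht U _ (by omega) hcomp
    omega
  obtain ⟨M, hM⟩ := hex
  have hm := hM.1
  have hsp := hM.2
  choose g hg hg' using fun v : (D : Set V) => hm (hsp v)
  refine ⟨fun v => if h : v ∈ D then (g ⟨v, h⟩).1 else v, ?_⟩
  intro v hv
  have h1 : (g ⟨v, hv⟩).1 ∈ D := (g ⟨v, hv⟩).2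
  simp only [hv, h1, dif_pos]
  refine ⟨trivial, ?_, ?_⟩
  · have := hg' (g ⟨v, hv⟩) ⟨v, hv⟩ (hg ⟨v, hv⟩).symm
    simp [← this]
  · exact (hg ⟨v, hv⟩).adj_sub


/-- `L` lists the vertices of a cycle of `G` in cyclic order. -/
structure Cyc (G : SimpleGraph V) (L : List V) : Prop where
  nodup : L.Nodup
  three : 3 ≤ L.length
  chain : L.IsChain G.Adj
  close : ∀ a ∈ L.getLast?, ∀ b ∈ L.head?, G.Adj a b

theorem Cyc.rotate {G : SimpleGraph V} {A B : List V} (h : Cyc G (A ++ B)) : Cyc G (B ++ A) := by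
  obtain ⟨h1, h2, h3, h4⟩ := h
  rcases eq_or_ne A [] with rfl | hA
  · simp_all; exact ⟨h1, h2, h3, by simpa using h4⟩
  rcases eq_or_ne B [] with rfl | hB
  · simp_all; exact ⟨h1, h2, h3, by simpa using h4⟩
  rw [List.isChain_append] at h3
  refine ⟨?_, ?_, ?_, ?_⟩
  · exact (List.perm_append_comm.nodup_iff).1 h1
  · simp at h2 ⊢; omega
  · rw [List.isChain_append]
    refine ⟨h3.2.1, h3.1, fun a ha b hb => h4 a ?_ b ?_⟩
    · rw [List.getLast?_append_of_ne_nil _ hB]; exact ha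
    · rw [List.head?_append_of_ne_nil _ hA]; exact hb
  · intro a ha b hb
    rw [List.getLast?_append_of_ne_nil _ hA] at ha
    rw [List.head?_append_of_ne_nil _ hB] at hb
    exact h3.2.2 a ha b hb

theorem walk_of_chain {G : SimpleGraph V} : ∀ (L : List V) (h : V), (h :: L).IsChain G.Adj →
    ∃ (t : V) (p : G.Walk h t), t ∈ (h :: L).getLast? ∧ p.support = h :: L
  | [], h, _ => ⟨h, Walk.nil, by simp, by simp⟩
  | b :: L, h, hc => by
    rw [List.isChain_cons_cons] at hc
    obtain ⟨t, p, h1, h2⟩ := walk_of_chain L b hc.2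
    exact ⟨t, Walk.cons hc.1 p, by simpa using h1, by simp [h2]⟩

theorem Cyc.hamiltonian [Fintype V] [DecidableEq V] {G : SimpleGraph V} {L : List V} (h : Cyc G L)
    (hL : L.length = Fintype.card V) : G.IsHamiltonian := by
  obtain ⟨h1, h2, h3, h4⟩ := h
  cases L with
  | nil => simp at h2
  | cons x L =>
    obtain ⟨t, p, ht, hp⟩ := walk_of_chain L x h3
    have hpath : p.IsPath := by
      rw [Walk.isPath_def, hp]; exact h1
    have hadj : G.Adj t x := h4 t ht x (by simp)
    have hlen : p.length + 1 = (x :: L).length := by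
      rw [← hp]; simp
    intro _
    refine ⟨t, Walk.cons hadj p, ?_⟩
    rw [Walk.isHamiltonianCycle_iff_isCycle_and_length_eq]
    refine ⟨?_, by rw [Walk.length_cons, hlen, hL]⟩
    rw [Walk.cons_isCycle_iff]
    refine ⟨hpath, ?_⟩
    cases p with
    | nil =>
      simp only [Walk.length_nil] at hlen
      omega
    | cons hxb q =>
      rename_i b
      rw [Walk.cons_isPath_iff] at hpath
      rw [Walk.edges_cons, List.mem_cons, not_or]
      constructor
      · intro he
        rw [Sym2.eq_iff] at he
        rcases he with he | he
        · exact hadj.ne he.1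
        · obtain ⟨rfl, _⟩ := he
          have := Walk.isPath_iff_nil.1 hpath.1
          rw [Walk.length_cons, Walk.length_eq_zero_iff.2 this] at hlen
          omega
      · intro he
        exact hpath.2 (Walk.snd_mem_support_of_mem_edges q he)

/-- `a` and `b` are consecutive on `P`, in some order. -/
def Nb (P : List V) (a b : V) : Prop := [a, b] <:+: P ∨ [b, a] <:+: P

theorem Nb.symm {P : List V} {a b : V} (h : Nb P a b) : Nb P b a := Or.symm h

theorem pair_infix_append {A B : List V} {a b : V} :
    [a, b] <:+: A ++ B ↔ [a, b] <:+: A ∨ [a, b] <:+: B ∨ (a ∈ A.getLast? ∧ b ∈ B.head?) := by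
  constructor
  · rintro ⟨s, t, h⟩
    rw [List.append_assoc] at h
    rcases List.append_eq_append_iff.1 h with ⟨as, rfl, h2⟩ | ⟨bs, rfl, h2⟩
    · match as, h2 with
      | [], h2 => exact Or.inr (Or.inl ⟨[], t, by simpa using h2⟩)
      | [x], h2 =>
        simp at h2
        obtain ⟨rfl, rfl⟩ := h2
        right; right; simp
      | x :: y :: as, h2 =>
        simp at h2
        obtain ⟨rfl, rfl, rfl⟩ := h2
        left
        exact ⟨s, as, by simp⟩
    · exact Or.inr (Or.inl ⟨bs, t, by simp [h2]⟩)
  · rintro (⟨s, t, rfl⟩ | ⟨s, t, rfl⟩ | ⟨h1, h2⟩)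
    · exact ⟨s, t ++ B, by simp⟩
    · exact ⟨A ++ s, t, by simp⟩
    · obtain ⟨A', rfl⟩ := List.getLast?_eq_some_iff.1 h1
      obtain ⟨B', rfl⟩ := List.head?_eq_some_iff.1 h2
      exact ⟨A', B', by simp⟩

theorem pair_infix_reverse {A : List V} {a b : V} :
    [a, b] <:+: A.reverse ↔ [b, a] <:+: A := by
  rw [← List.reverse_infix, List.reverse_reverse]
  simp


/-- Lists obtained from `P` by Posa rotations with the last vertex fixed. -/
inductive Reach (G : SimpleGraph V) (P : List V) : List V → Prop
  | refl : Reach G P P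
  | rot (v : V) (A : List V) (w : V) (B : List V) (h : Reach G P (v :: A ++ w :: B))
      (hvw : G.Adj v w) : Reach G P ((v :: A).reverse ++ w :: B)

theorem Reach.perm {G : SimpleGraph V} {P Q : List V} (h : Reach G P Q) : Q.Perm P := by
  induction h with
  | refl => exact List.Perm.refl _
  | rot v A w B h hvw ih => exact ((List.reverse_perm (v :: A)).append_right _).trans ih

theorem Reach.last {G : SimpleGraph V} {P Q : List V} (h : Reach G P Q) :
    Q.getLast? = P.getLast? := by
  induction h with
  | refl => rfl
  | rot v A w B h hvw ih =>
    rw [← ih, List.getLast?_append_of_ne_nil _ (by simp), List.getLast?_append_of_ne_nil _ (by simp)]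

theorem Reach.chain {G : SimpleGraph V} {P Q : List V} (h : Reach G P Q) (hP : P.IsChain G.Adj) :
    Q.IsChain G.Adj := by
  induction h with
  | refl => exact hP
  | rot v A w B h hvw ih =>
    rw [List.isChain_append] at ih ⊢
    refine ⟨?_, ih.2.1, ?_⟩
    · rw [List.isChain_reverse]
      exact ih.1.imp fun a b h => h.symm
    · intro a ha b hb
      simp at ha hb
      subst ha; subst hb
      exact hvw

theorem succ_unique {P : List V} (hP : P.Nodup) {u w w' : V} (h : [u, w] <:+: P)
    (h' : [u, w'] <:+: P) : w = w' := by
  classical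
  obtain ⟨s, t, rfl⟩ := h
  obtain ⟨s', t', h'⟩ := h'
  simp only [List.append_assoc, List.cons_append, List.nil_append] at h' hP
  have hP' := hP
  rw [← h'] at hP'
  have h1 : u ∉ s := by
    intro hu
    exact (List.nodup_append.1 hP).2.2 u hu u (by simp) rfl
  have h2 : u ∉ s' := by
    intro hu
    exact (List.nodup_append.1 hP').2.2 u hu u (by simp) rfl
  have hl : s'.length = s.length := by
    have e1 : (s ++ u :: w :: t).idxOf u = s.length := by
      rw [List.idxOf_append_of_notMem h1]; simp
    have e2 : (s' ++ u :: w' :: t').idxOf u = s'.length := by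
      rw [List.idxOf_append_of_notMem h2]; simp
    rw [h'] at e2
    exact e2.symm.trans e1
  have := (List.append_inj h' hl).2
  simp at this
  exact this.1.symm

theorem pred_unique {P : List V} (hP : P.Nodup) {u w w' : V} (h : [w, u] <:+: P)
    (h' : [w', u] <:+: P) : w = w' := by
  apply succ_unique (P := P.reverse) (by simpa using hP)
  · exact pair_infix_reverse.2 h
  · exact pair_infix_reverse.2 h'

theorem posa_nb {G : SimpleGraph V} {P Q : List V} (h : Reach G P Q) (w : V)
    (hw : ∀ T, ¬ Reach G P (w :: T))
    (hnb : ∀ u T, Reach G P (u :: T) → ¬ Nb P u w) : ∀ a, Nb Q a w → Nb P a w := by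
  induction h with
  | refl => exact fun a h => h
  | rot v A w' B h hvw ih =>
    intro a ha
    have hv : v ≠ w := by
      rintro rfl
      exact hw _ h
    obtain ⟨v', hv'⟩ : ∃ v', v' ∈ (v :: A).getLast? := by
      rw [List.getLast?_eq_some_getLast (by simp)]
      exact ⟨_, rfl⟩
    have hw' : w' ≠ w := by
      rintro rfl
      obtain ⟨A', hA'⟩ := List.getLast?_eq_some_iff.1 hv'
      have h2 : Reach G P (v' :: (A'.reverse ++ w' :: B)) := by
        have := Reach.rot v A w' B h hvw
        rw [hA'] at this
        simpa using this
      refine hnb v' _ h2 (ih v' (Or.inl ?_))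
      exact pair_infix_append.2 (Or.inr (Or.inr ⟨hv', by simp⟩))
    apply ih
    unfold Nb at ha ⊢
    rw [pair_infix_append, pair_infix_append, pair_infix_reverse, pair_infix_reverse] at ha
    rw [pair_infix_append, pair_infix_append]
    rcases ha with (h | h | h) | (h | h | h)
    · exact Or.inr (Or.inl h)
    · exact Or.inl (Or.inr (Or.inl h))
    · simp at h; exact absurd h.2 hw'
    · exact Or.inl (Or.inl h)
    · exact Or.inr (Or.inr (Or.inl h))
    · simp at h; exact absurd h.1 hv

theorem posa_contra [Fintype V] {G : SimpleGraph V} (ht : Tough 3 G) (h4 : 4 ≤ Fintype.card V)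
    {P : List V} (hne : P ≠ []) (hP : P.Nodup)
    (hN : ∀ v T, Reach G P (v :: T) → ∀ w, G.Adj v w → w ∈ P)
    (hI : ∀ u T v T', Reach G P (u :: T) → Reach G P (v :: T') → ¬ G.Adj u v) : False := by
  classical
  let I : Finset V := Finset.univ.filter (fun v => ∃ T, Reach G P (v :: T))
  have hmem : ∀ v, v ∈ I ↔ ∃ T, Reach G P (v :: T) := by simp [I]
  have hIne : I.Nonempty := by
    cases P with
    | nil => exact absurd rfl hne
    | cons x T => exact ⟨x, (hmem x).2 ⟨T, Reach.refl⟩⟩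
  have hT := tough_T ht I (by
    intro u hu v hv
    obtain ⟨T, hT⟩ := (hmem u).1 hu
    obtain ⟨T', hT'⟩ := (hmem v).1 hv
    exact hI u T v T' hT hT') hIne h4
  let sc : V → V := fun u => if h : ∃ w, [u, w] <:+: P then h.choose else u
  let pr : V → V := fun u => if h : ∃ w, [w, u] <:+: P then h.choose else u
  have hsub : nbr G I ⊆ I.image sc ∪ I.image pr := by
    intro w hw
    obtain ⟨v, hv, hvw⟩ := mem_nbr.1 hw
    obtain ⟨T, hT⟩ := (hmem v).1 hv
    have hex : ∃ u T, Reach G P (u :: T) ∧ Nb P u w := by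
      by_contra hcon
      push Not at hcon
      have hw' : ∀ T, ¬ Reach G P (w :: T) := fun T' hT' => hI v T w T' hT hT' hvw
      have hwP : w ∈ v :: T := hT.perm.mem_iff.2 (hN v T hT w hvw)
      have hwT : w ∈ T := by
        rcases List.mem_cons.1 hwP with rfl | h
        · exact absurd hvw (G.loopless.irrefl _)
        · exact h
      obtain ⟨A, B, rfl⟩ := List.append_of_mem hwT
      obtain ⟨v', hv'⟩ : ∃ v', v' ∈ (v :: A).getLast? := by
        rw [List.getLast?_eq_some_getLast (by simp)]
        exact ⟨_, rfl⟩
      obtain ⟨A', hA'⟩ := List.getLast?_eq_some_iff.1 hv'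
      have h2 : Reach G P (v' :: (A'.reverse ++ w :: B)) := by
        have := Reach.rot v A w B hT hvw
        rw [hA'] at this
        simpa using this
      refine hcon v' _ h2 (posa_nb hT w hw' hcon v' (Or.inl ?_))
      rw [← List.cons_append]
      exact pair_infix_append.2 (Or.inr (Or.inr ⟨hv', by simp⟩))
    obtain ⟨u, T', hT', hnb⟩ := hex
    have hu : u ∈ I := (hmem u).2 ⟨T', hT'⟩
    rw [Finset.mem_union, Finset.mem_image, Finset.mem_image]
    rcases hnb with h | h
    · left
      have hx : ∃ w, [u, w] <:+: P := ⟨w, h⟩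
      refine ⟨u, hu, ?_⟩
      simp only [sc, dif_pos hx]
      exact succ_unique hP hx.choose_spec h
    · right
      have hx : ∃ w, [w, u] <:+: P := ⟨w, h⟩
      refine ⟨u, hu, ?_⟩
      simp only [pr, dif_pos hx]
      exact pred_unique hP hx.choose_spec h
  have h1 := Finset.card_le_card hsub
  have h2 := Finset.card_union_le (I.image sc) (I.image pr)
  have h3 := Finset.card_image_le (s := I) (f := sc)
  have h5 := Finset.card_image_le (s := I) (f := pr)
  omega


theorem exists_max_list [Fintype V] (p : List V → Prop) (hp : ∃ P, p P)
    (hn : ∀ P, p P → P.Nodup) : ∃ P, p P ∧ ∀ P', p P' → P'.length ≤ P.length := by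
  let S : Set ℕ := List.length '' {P | p P}
  have hne : S.Nonempty := by
    obtain ⟨P, hP⟩ := hp
    exact ⟨_, P, hP, rfl⟩
  have hb : BddAbove S := by
    refine ⟨Fintype.card V, ?_⟩
    rintro _ ⟨P, hP, rfl⟩
    exact (hn P hP).length_le_card
  obtain ⟨P, hP, hlen⟩ := Nat.sSup_mem hne hb
  refine ⟨P, hP, fun P' hP' => ?_⟩
  rw [hlen]
  exact le_csSup hb ⟨P', hP', rfl⟩

theorem Cyc.insert {G : SimpleGraph V} {X Y : List V} {a b x : V} (h : Cyc G (X ++ a :: b :: Y))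
    (hx : x ∉ X ++ a :: b :: Y) (hax : G.Adj a x) (hxb : G.Adj x b) :
    Cyc G (X ++ a :: x :: b :: Y) := by
  obtain ⟨h1, h2, h3, h4⟩ := h
  have hperm : (X ++ a :: x :: b :: Y).Perm (x :: (X ++ a :: b :: Y)) := by
    have : X ++ a :: x :: b :: Y = (X ++ [a]) ++ x :: (b :: Y) := by simp
    rw [this]
    refine List.perm_middle.trans ?_
    simp
  refine ⟨hperm.nodup_iff.2 (List.nodup_cons.2 ⟨hx, h1⟩), ?_, ?_, ?_⟩
  · simp at h2 ⊢; omega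
  · rw [List.isChain_append_cons_cons] at h3 ⊢
    refine ⟨h3.1, hax, ?_⟩
    rw [List.isChain_cons_cons]
    exact ⟨hxb, h3.2.2⟩
  · intro u hu v hv
    apply h4 u _ v _
    · rw [List.getLast?_append_of_ne_nil _ (by simp)] at hu ⊢
      simpa using hu
    · cases X <;> simpa using hv

theorem length_lt_of_subset {L Q : List V} {x : V} (hL : L.Nodup)
    (hsub : ∀ v ∈ L, v ∈ Q) (hx : x ∉ L) (hxQ : x ∈ Q) : L.length < Q.length := by
  have h1 : (x :: L).Nodup := List.nodup_cons.2 ⟨hx, hL⟩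
  have h2 : (x :: L) ⊆ Q := by
    intro y hy
    rcases List.mem_cons.1 hy with rfl | h
    · exact hxQ
    · exact hsub y h
  have := (h1.subperm h2).length_le
  simp at this
  omega

/-- The family of lists used in the rotation argument. -/
structure Fam (G : SimpleGraph V) (f : V → V) (L : List V) (t h x0 : V) (P : List V) : Prop where
  nodup : P.Nodup
  chain : P.IsChain G.Adj
  last : P.getLast? = some x0
  closed : ∀ v, v ∉ L → v ∉ P → f v ∉ P
  alt : (∀ v ∈ P, v ∉ L) ∨ ((∀ v ∈ L, v ∈ P) ∧ Nb P t h)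

/-- Maximality of the cycle `L`. -/
def MaxCyc (G : SimpleGraph V) (f : V → V) (L : List V) : Prop :=
  ∀ L', Cyc G L' → (∀ v ∈ L, v ∈ L') → (∀ v, v ∉ L' → f v ∉ L') → L'.length ≤ L.length

theorem key_no {G : SimpleGraph V} {f : V → V} {L : List V} {x0 : V} (hL : Cyc G L)
    (hmax : MaxCyc G f L) (hx0 : x0 ∉ L) {v : V} {T : List V}
    (hnd : (v :: T).Nodup) (hch : (v :: T).IsChain G.Adj) (hlast : (v :: T).getLast? = some x0)
    (hcl : ∀ z, z ∉ L → z ∉ v :: T → f z ∉ v :: T) (hsub : ∀ z ∈ L, z ∈ v :: T) :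
    ¬ G.Adj v x0 := by
  intro hadj
  have hxQ : x0 ∈ v :: T := List.mem_of_getLast? hlast
  have hlt := length_lt_of_subset hL.nodup hsub hx0 hxQ
  have hc : Cyc G (v :: T) := by
    refine ⟨hnd, ?_, hch, ?_⟩
    · have := hL.three; omega
    · intro a ha b hb
      rw [hlast] at ha
      simp at ha hb
      subst ha; subst hb
      exact hadj.symm
  have := hmax _ hc hsub (fun z hz => hcl z (fun h => hz (hsub z h)) hz)
  omega

theorem reach_fam {G : SimpleGraph V} {f : V → V} {L : List V} {t h x0 : V} (hL : Cyc G L)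
    (hmax : MaxCyc G f L) (hx0 : x0 ∉ L) (hxt : G.Adj x0 t) (hxh : G.Adj x0 h)
    {P Q : List V} (hP : Fam G f L t h x0 P) (hr : Reach G P Q) : Fam G f L t h x0 Q := by
  have hmem : ∀ {Q'}, Reach G P Q' → ∀ v, v ∈ Q' ↔ v ∈ P := fun hr v => hr.perm.mem_iff
  have hcl : ∀ {Q'}, Reach G P Q' → ∀ v, v ∉ L → v ∉ Q' → f v ∉ Q' := by
    intro Q' hr v h1 h2
    rw [hmem hr] at h2 ⊢
    exact hP.closed v h1 h2
  refine ⟨hr.perm.nodup_iff.2 hP.nodup, hr.chain hP.chain, by rw [hr.last, hP.last], hcl hr, ?_⟩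
  rcases hP.alt with hi | hii
  · left
    intro v hv
    exact hi v ((hmem hr v).1 hv)
  · right
    refine ⟨fun v hv => (hmem hr v).2 (hii.1 v hv), ?_⟩
    induction hr with
    | refl => exact hii.2
    | rot v A w B hr hvw ih =>
      have hr' := Reach.rot v A w B hr hvw
      have main : ∀ a b, G.Adj x0 a → [a, b] <:+: v :: A ++ w :: B →
          Nb ((v :: A).reverse ++ w :: B) a b := by
        intro a b ha hab
        rcases pair_infix_append.1 hab with h1 | h1 | h1
        · exact Or.inr (pair_infix_append.2 (Or.inl (pair_infix_reverse.2 h1)))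
        · exact Or.inl (pair_infix_append.2 (Or.inr (Or.inl h1)))
        · exfalso
          obtain ⟨A', hA'⟩ := List.getLast?_eq_some_iff.1 h1.1
          have e : (v :: A).reverse ++ w :: B = a :: (A'.reverse ++ w :: B) := by
            rw [hA']; simp
          rw [e] at hr'
          refine key_no hL hmax hx0 (hr'.perm.nodup_iff.2 hP.nodup) (hr'.chain hP.chain)
            (by rw [hr'.last, hP.last]) (hcl hr') (fun z hz => (hmem hr' z).2 (hii.1 z hz)) ha.symm
      have main' : ∀ a b, G.Adj x0 a → G.Adj x0 b → Nb (v :: A ++ w :: B) a b →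
          Nb ((v :: A).reverse ++ w :: B) a b := by
        intro a b ha hb hab
        rcases hab with h1 | h1
        · exact main a b ha h1
        · exact (main b a hb h1).symm
      exact main' t h hxt hxh ih

theorem cyc_path {G : SimpleGraph V} {h t d : V} {M : List V} (hL : Cyc G (h :: (M ++ [t])))
    (hd : d ∈ h :: (M ++ [t])) : ∃ K : List V, K.Perm (h :: (M ++ [t])) ∧ K.IsChain G.Adj ∧
      K.getLast? = some d ∧ Nb K t h := by
  obtain ⟨L1, L2, he⟩ := List.append_of_mem hd
  cases L1 with
  | nil =>
    simp at he
    obtain ⟨rfl, rfl⟩ := he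
    have := Cyc.rotate (A := [h]) (B := M ++ [t]) (by simpa using hL)
    refine ⟨(M ++ [t]) ++ [h], ?_, this.chain, by simp, Or.inl ⟨M, [], by simp⟩⟩
    exact List.perm_append_comm
  | cons y L1 =>
    have hy : y = h := by simpa using congrArg List.head? he.symm
    subst hy
    have hl : (d :: L2).getLast? = some t := by
      have := congrArg List.getLast? he
      rw [List.getLast?_append_of_ne_nil _ (by simp), ← List.cons_append,
        List.getLast?_append_of_ne_nil _ (by simp)] at this
      rw [← this]; simp
    rw [he] at hL ⊢
    refine ⟨((d :: L2) ++ (y :: L1)).reverse, ?_, ?_, by rw [List.getLast?_reverse]; simp, Or.inr ?_⟩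
    · exact (List.reverse_perm _).trans List.perm_append_comm
    · rw [List.isChain_reverse]
      exact hL.rotate.chain.imp fun a b h => h.symm
    · rw [pair_infix_reverse]
      exact pair_infix_append.2 (Or.inr (Or.inr ⟨hl, by simp⟩))

theorem no_run [Fintype V] {G : SimpleGraph V} (ht : Tough 3 G) (hfree : TwoK2Free G)
    (h4 : 4 ≤ Fintype.card V)
    {f : V → V} {M : List V} {t h x0 : V} (hL : Cyc G (h :: (M ++ [t])))
    (hf : ∀ v, v ∉ h :: (M ++ [t]) → f v ∉ h :: (M ++ [t]) ∧ f (f v) = v ∧ G.Adj v (f v))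
    (hmax : MaxCyc G f (h :: (M ++ [t]))) (hx0 : x0 ∉ h :: (M ++ [t]))
    (hxt : G.Adj x0 t) (hxh : G.Adj x0 h) : False := by
  set L := h :: (M ++ [t]) with hLdef
  have hth : G.Adj t h := hL.close t
    (List.getLast?_eq_some_iff.2 ⟨h :: M, by simp [hLdef]⟩) h (by simp [hLdef])
  have htL : t ∈ L := by simp [hLdef]
  have hhL : h ∈ L := by simp [hLdef]
  obtain ⟨P, hP, hPmax⟩ := exists_max_list (Fam G f L t h x0) (by
    obtain ⟨h1, h2, h3⟩ := hf x0 hx0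
    refine ⟨[f x0, x0], ?_, ?_, by simp, ?_, Or.inl ?_⟩
    · simpa using h3.ne.symm
    · simpa using h3.symm
    · intro v hv hv'
      obtain ⟨g1, g2, g3⟩ := hf v hv
      simp at hv' ⊢
      refine ⟨fun e => hv'.2 ?_, fun e => hv'.1 ?_⟩
      · rw [← g2, e, h2]
      · rw [← g2, e]
    · intro v hv
      simp at hv
      rcases hv with rfl | rfl <;> assumption) (fun P hP => hP.nodup)
  have hrf : ∀ {Q}, Reach G P Q → Fam G f L t h x0 Q :=
    fun hr => reach_fam hL hmax hx0 hxt hxh hP hr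
  have hlen : ∀ {Q}, Reach G P Q → Q.length = P.length := fun hr => hr.perm.length_eq
  have ha : ∀ v T, Reach G P (v :: T) → ∀ y, y ∉ L → y ∉ v :: T → ¬ G.Adj v y := by
    intro v T hr y hyL hyP hadj
    have hQ := hrf hr
    obtain ⟨g1, g2, g3⟩ := hf y hyL
    have hfy := hQ.closed y hyL hyP
    have : Fam G f L t h x0 (f y :: y :: v :: T) := by
      refine ⟨?_, ?_, ?_, ?_, ?_⟩
      · rw [List.nodup_cons, List.nodup_cons]
        refine ⟨?_, hyP, hQ.nodup⟩
        rw [List.mem_cons, not_or]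
        exact ⟨g3.ne.symm, hfy⟩
      · rw [List.isChain_cons_cons, List.isChain_cons_cons]
        exact ⟨g3.symm, hadj.symm, hQ.chain⟩
      · rw [List.getLast?_cons_cons, List.getLast?_cons_cons, hQ.last]
      · intro z hz hz'
        rw [List.mem_cons, List.mem_cons, not_or, not_or] at hz' ⊢
        obtain ⟨k1, k2, k3⟩ := hf z hz
        refine ⟨fun e => hz'.2.1 ?_, fun e => hz'.1 ?_, hQ.closed z hz hz'.2.2⟩
        · rw [← k2, e, g2]
        · rw [← k2, e]
      · rcases hQ.alt with hi | hii
        · left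
          intro z hz
          rw [List.mem_cons, List.mem_cons] at hz
          rcases hz with rfl | rfl | hz
          · exact g1
          · exact hyL
          · exact hi z hz
        · right
          refine ⟨fun z hz => List.mem_cons_of_mem _ (List.mem_cons_of_mem _ (hii.1 z hz)), ?_⟩
          have hs : v :: T <:+: f y :: y :: v :: T := ⟨[f y, y], [], by simp⟩
          exact hii.2.imp (fun h => h.trans hs) (fun h => h.trans hs)
    have h1 := hPmax _ this
    have h2 := hlen hr
    simp at h1 h2
    omega
  have hne : P ≠ [] := by
    intro e
    have := hP.last
    rw [e] at this
    simp at this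
  rcases hP.alt with hi | hii
  · have hb : ∀ v T, Reach G P (v :: T) → ∀ d ∈ L, ¬ G.Adj v d := by
      intro v T hr d hd hadj
      have hQ := hrf hr
      have hi' : ∀ z ∈ v :: T, z ∉ L := fun z hz => hi z (hr.perm.mem_iff.1 hz)
      obtain ⟨K, k1, k2, k3, k4⟩ := cyc_path hL hd
      have : Fam G f L t h x0 (K ++ v :: T) := by
        refine ⟨?_, ?_, ?_, ?_, Or.inr ⟨?_, ?_⟩⟩
        · rw [List.nodup_append]
          refine ⟨k1.nodup_iff.2 hL.nodup, hQ.nodup, ?_⟩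
          rintro z hz _ hz' rfl
          exact hi' z hz' (k1.mem_iff.1 hz)
        · rw [List.isChain_append]
          refine ⟨k2, hQ.chain, ?_⟩
          intro a ha b hb
          rw [k3] at ha
          simp at ha hb
          subst ha; subst hb
          exact hadj.symm
        · rw [List.getLast?_append_of_ne_nil _ (by simp), hQ.last]
        · intro z hz hz'
          rw [List.mem_append, not_or] at hz' ⊢
          refine ⟨fun hh => (hf z hz).1 (k1.mem_iff.1 hh), hQ.closed z hz hz'.2⟩
        · intro z hz
          exact List.mem_append_left _ (k1.mem_iff.2 hz)
        · have hs : K <:+: K ++ v :: T := ⟨[], v :: T, by simp⟩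
          exact k4.imp (fun h => h.trans hs) (fun h => h.trans hs)
      have h1 := hPmax _ this
      have h2 := hlen hr
      have h3 : K.length = L.length := k1.length_eq
      have h5 := hL.three
      rw [List.length_append] at h1
      omega
    refine posa_contra ht h4 hne hP.nodup ?_ ?_
    · intro v T hr w hvw
      by_contra hw
      by_cases hwL : w ∈ L
      · exact hb v T hr w hwL hvw
      · exact ha v T hr w hwL (fun hh => hw (hr.perm.mem_iff.1 hh)) hvw
    · intro u T v T' hu hv huv
      have hi1 : u ∉ L := hi u (hu.perm.mem_iff.1 (by simp))
      have hi2 : v ∉ L := hi v (hv.perm.mem_iff.1 (by simp))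
      rcases twoK2 hfree huv hth (fun e => hi1 (e ▸ htL)) (fun e => hi1 (e ▸ hhL))
        (fun e => hi2 (e ▸ htL)) (fun e => hi2 (e ▸ hhL)) with h1 | h1 | h1 | h1
      · exact hb u T hu _ htL h1
      · exact hb u T hu _ hhL h1
      · exact hb v T' hv _ htL h1
      · exact hb v T' hv _ hhL h1
  · have hsub : ∀ {Q}, Reach G P Q → ∀ z ∈ L, z ∈ Q :=
      fun hr z hz => hr.perm.mem_iff.2 (hii.1 z hz)
    have hx0P : x0 ∈ P := List.mem_of_getLast? hP.last
    have hPlen := length_lt_of_subset hL.nodup hii.1 hx0 hx0P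
    have hL3 := hL.three
    have hnb : ∀ {Q}, Reach G P Q → Nb Q t h := by
      intro Q hr
      rcases (hrf hr).alt with h1 | h1
      · exact absurd htL (h1 t (hsub hr t htL))
      · exact h1.2
    have hnx : ∀ v T, Reach G P (v :: T) → ¬ G.Adj v x0 := by
      intro v T hr
      have hQ := hrf hr
      exact key_no hL hmax hx0 hQ.nodup hQ.chain hQ.last hQ.closed (hsub hr)
    obtain ⟨P1, hP1⟩ := List.getLast?_eq_some_iff.1 hP.last
    obtain ⟨P0, s, rfl⟩ : ∃ P0 s, P1 = P0 ++ [s] := by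
      rcases List.eq_nil_or_concat P1 with e | ⟨P0, s, e⟩
      · rw [e] at hP1
        rw [hP1] at hPlen
        simp at hPlen
      · exact ⟨P0, s, by simpa using e⟩
    have hguard : ∀ {Q}, Reach G P Q → [s, x0] <:+ Q := by
      intro Q hr
      induction hr with
      | refl => exact ⟨P0, by rw [hP1]; simp⟩
      | rot v A w B hr hvw ih =>
        have hwx : w ≠ x0 := by
          rintro rfl
          exact hnx v _ hr hvw
        have hB : B ≠ [] := by
          rintro rfl
          have := hr.last
          rw [hP.last, List.getLast?_append_of_ne_nil _ (by simp)] at this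
          simp at this
          exact hwx this
        have h1 : [s, x0] <:+ w :: B := by
          refine List.suffix_of_suffix_length_le ih (List.suffix_append _ _) ?_
          have := List.length_pos_iff.2 hB
          simp
          omega
        exact h1.trans (List.suffix_append _ _)
    have hxt' : x0 ≠ t := fun e => hx0 (e ▸ htL)
    have hxh' : x0 ≠ h := fun e => hx0 (e ▸ hhL)
    have hns : ∀ v T, Reach G P (v :: T) → v ≠ s ∧ v ≠ x0 ∧ ¬ G.Adj v s := by
      intro v T hr
      have hQ := hrf hr
      have hl := hlen hr
      obtain ⟨Q0, hQ0⟩ := hguard hr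
      cases Q0 with
      | nil =>
        have := congrArg List.length hQ0
        simp at this hl
        omega
      | cons v' Q0 =>
      obtain ⟨rfl, rfl⟩ : v' = v ∧ Q0 ++ [s, x0] = T := by simpa using hQ0
      have hnd := hQ.nodup
      refine ⟨?_, ?_, ?_⟩
      · rintro rfl
        simp at hnd
      · rintro rfl
        simp at hnd
      · intro hadj
        have e : v' :: (Q0 ++ [s, x0]) = (v' :: (Q0 ++ [s])) ++ [x0] := by simp
        rw [e] at hr hQ
        have hx0R : x0 ∉ v' :: (Q0 ++ [s]) := by
          intro hh
          have := (List.nodup_append.1 hQ.nodup).2.2 x0 hh x0 (by simp)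
          exact this rfl
        have hcR : Cyc G (v' :: (Q0 ++ [s])) := by
          refine ⟨(List.nodup_append.1 hQ.nodup).1, ?_, hQ.chain.left_of_append, ?_⟩
          · have := hr.perm.length_eq
            simp at this ⊢
            omega
          · intro a ha b hb
            rw [← List.cons_append, List.getLast?_append_of_ne_nil _ (by simp)] at ha
            simp at ha hb
            subst ha; subst hb
            exact hadj.symm
        have main : ∀ a b, G.Adj x0 a → G.Adj x0 b → x0 ≠ b →
            [a, b] <:+: (v' :: (Q0 ++ [s])) ++ [x0] → False := by
          intro a b hxa hxb hne hab
          rcases pair_infix_append.1 hab with h1 | h1 | h1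
          · obtain ⟨X, Y, hXY⟩ := h1
            have hXY' : X ++ a :: b :: Y = v' :: (Q0 ++ [s]) := by simpa using hXY
            rw [← hXY'] at hcR hx0R
            have hins := hcR.insert hx0R hxa.symm hxb
            have hperm : (X ++ a :: x0 :: b :: Y).Perm P := by
              refine List.Perm.trans ?_ hr.perm
              rw [← hXY']
              have : X ++ a :: x0 :: b :: Y = (X ++ [a]) ++ x0 :: (b :: Y) := by simp
              rw [this]
              refine List.perm_middle.trans ?_
              refine List.Perm.trans ?_ List.perm_append_comm
              simp
            have := hmax _ hins (fun z hz => hperm.mem_iff.2 (hii.1 z hz)) (by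
              intro z hz
              rw [hperm.mem_iff] at hz ⊢
              exact hP.closed z (fun hh => hz (hii.1 z hh)) hz)
            have := hperm.length_eq
            omega
          · have := h1.length_le
            simp at this
          · simp at h1
            exact hne h1.2
        rcases hnb hr with h1 | h1
        · exact main t h hxt hxh hxh' h1
        · exact main h t hxh hxt hxt' h1
    refine posa_contra ht h4 hne hP.nodup ?_ ?_
    · intro v T hr w hvw
      by_contra hw
      by_cases hwL : w ∈ L
      · exact hw (hii.1 w hwL)
      · exact ha v T hr w hwL (fun hh => hw (hr.perm.mem_iff.1 hh)) hvw
    · intro u T v T' hu hv huv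
      have hsx : G.Adj s x0 := by
        have := hP.chain
        rw [hP1] at this
        exact this.rel_getLast_head_of_append (by simp) (by simp) |> fun h => by simpa using h
      obtain ⟨a1, a2, a3⟩ := hns u T hu
      obtain ⟨b1, b2, b3⟩ := hns v T' hv
      rcases twoK2 hfree huv hsx a1 a2 b1 b2 with h1 | h1 | h1 | h1
      · exact a3 h1
      · exact hnx u T hu h1
      · exact b3 h1
      · exact hnx v T' hv h1


/-- `c` is adjacent to one of `x`, `f x`. -/
def Tch (G : SimpleGraph V) (f : V → V) (x c : V) : Prop := G.Adj c x ∨ G.Adj c (f x)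

theorem no_bridge {G : SimpleGraph V} {f : V → V} {M : List V} {t h x : V}
    (hL : Cyc G (h :: (M ++ [t])))
    (hf : ∀ v, v ∉ h :: (M ++ [t]) → f v ∉ h :: (M ++ [t]) ∧ f (f v) = v ∧ G.Adj v (f v))
    (hmax : MaxCyc G f (h :: (M ++ [t]))) (hx : x ∉ h :: (M ++ [t]))
    (hxt : G.Adj t x) (hxh : G.Adj h (f x)) : False := by
  obtain ⟨g1, g2, g3⟩ := hf x hx
  have hc : Cyc G ((h :: (M ++ [t])) ++ [x, f x]) := by
    refine ⟨?_, ?_, ?_, ?_⟩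
    · rw [List.nodup_append]
      refine ⟨hL.nodup, by simpa using g3.ne, ?_⟩
      rintro a ha b hb rfl
      simp only [List.mem_cons, List.not_mem_nil, or_false] at hb
      rcases hb with rfl | rfl
      · exact hx ha
      · exact g1 ha
    · simp
    · rw [List.isChain_append]
      refine ⟨hL.chain, by simpa using g3, ?_⟩
      intro a ha b hb
      rw [← List.cons_append, List.getLast?_append_of_ne_nil _ (by simp)] at ha
      simp at ha hb
      subst ha; subst hb
      exact hxt
    · intro a ha b hb
      rw [List.getLast?_append_of_ne_nil _ (by simp)] at ha
      simp at ha hb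
      subst ha; subst hb
      exact hxh.symm
  have := hmax _ hc (fun v hv => List.mem_append_left _ hv) (by
    intro v hv
    rw [List.mem_append, not_or] at hv ⊢
    obtain ⟨k1, k2, k3⟩ := hf v hv.1
    refine ⟨k1, ?_⟩
    have h2 := hv.2
    simp only [List.mem_cons, List.not_mem_nil, or_false, not_or] at h2 ⊢
    refine ⟨fun e => h2.2 ?_, fun e => h2.1 ?_⟩
    · rw [← k2, e]
    · rw [← k2, e, g2])
  simp at this

theorem tch_pair [Fintype V] {G : SimpleGraph V} (ht : Tough 3 G) (hfree : TwoK2Free G)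
    (h4 : 4 ≤ Fintype.card V)
    {f : V → V} {M : List V} {t h x : V} (hL : Cyc G (h :: (M ++ [t])))
    (hf : ∀ v, v ∉ h :: (M ++ [t]) → f v ∉ h :: (M ++ [t]) ∧ f (f v) = v ∧ G.Adj v (f v))
    (hmax : MaxCyc G f (h :: (M ++ [t]))) (hx : x ∉ h :: (M ++ [t])) :
    (Tch G f x t ↔ ¬ Tch G f x h) := by
  obtain ⟨g1, g2, g3⟩ := hf x hx
  have hth : G.Adj t h := hL.close t
    (List.getLast?_eq_some_iff.2 ⟨h :: M, by simp⟩) h (by simp)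
  have htL : t ∈ h :: (M ++ [t]) := by simp
  have hhL : h ∈ h :: (M ++ [t]) := by simp
  constructor
  · rintro (h1 | h1) (h2 | h2)
    · exact no_run ht hfree h4 hL hf hmax hx h1.symm h2.symm
    · exact no_bridge hL hf hmax hx h1 h2
    · exact no_bridge hL hf hmax g1 h1 (by rw [g2]; exact h2)
    · exact no_run ht hfree h4 hL hf hmax g1 h1.symm h2.symm
  · intro hh
    unfold Tch at hh ⊢
    have := twoK2 hfree hth g3 (fun e => hx (e ▸ htL)) (fun e => g1 (e ▸ htL))
      (fun e => hx (e ▸ hhL)) (fun e => g1 (e ▸ hhL))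
    tauto

theorem tch_chain [Fintype V] {G : SimpleGraph V} (ht : Tough 3 G) (hfree : TwoK2Free G)
    (h4 : 4 ≤ Fintype.card V) {f : V → V} {L : List V} {x : V} (hL : Cyc G L)
    (hf : ∀ v, v ∉ L → f v ∉ L ∧ f (f v) = v ∧ G.Adj v (f v))
    (hmax : MaxCyc G f L) (hx : x ∉ L) :
    L.IsChain (fun a b => (Tch G f x a ↔ ¬ Tch G f x b)) := by
  rw [List.isChain_iff_forall_rel_of_append_cons_cons]
  intro a b X Y e
  have e1 : L = (X ++ [a]) ++ (b :: Y) := by rw [e]; simp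
  have hperm : (b :: ((Y ++ X) ++ [a])).Perm L := by
    rw [e1]
    have : b :: ((Y ++ X) ++ [a]) = (b :: Y) ++ (X ++ [a]) := by simp
    rw [this]
    exact List.perm_append_comm
  have hL' : Cyc G (b :: ((Y ++ X) ++ [a])) := by
    rw [e1] at hL
    have := hL.rotate
    simpa using this
  have hm : ∀ v, v ∈ b :: ((Y ++ X) ++ [a]) ↔ v ∈ L := fun v => hperm.mem_iff
  apply tch_pair ht hfree h4 hL'
  · intro v hv
    rw [hm] at hv ⊢
    exact hf v hv
  · intro L' h1 h2 h3
    rw [hperm.length_eq]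
    exact hmax L' h1 (fun v hv => h2 v ((hm v).2 hv)) h3
  · rw [hm]; exact hx

theorem alt_propagate {p q : V → Prop} : ∀ {L : List V}, L.IsChain (fun a b => (p a ↔ ¬ p b)) →
    L.IsChain (fun a b => (q a ↔ ¬ q b)) →
    (∀ c ∈ L, (p c ↔ q c)) ∨ (∀ c ∈ L, (p c ↔ ¬ q c))
  | [], _, _ => by simp
  | [a], _, _ => by
    simp only [List.mem_singleton, forall_eq]
    tauto
  | a :: b :: L, hp, hq => by
    rw [List.isChain_cons_cons] at hp hq
    rcases alt_propagate hp.2 hq.2 with h | h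
    · left
      have := h b (by simp)
      intro c hc
      rcases List.mem_cons.1 hc with rfl | hc
      · tauto
      · exact h c hc
    · right
      have := h b (by simp)
      intro c hc
      rcases List.mem_cons.1 hc with rfl | hc
      · tauto
      · exact h c hc

open Classical in
theorem alt_count {p : V → Prop} : ∀ {L : List V}, L.IsChain (fun a b => (p a ↔ ¬ p b)) →
    (L.filter (fun c => p c)).length ≤ (L.filter (fun c => ¬ p c)).length + 1 ∧
    (∀ a ∈ L.head?, ¬ p a →
      (L.filter (fun c => p c)).length ≤ (L.filter (fun c => ¬ p c)).length)
  | [], _ => by simp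
  | [a], _ => by by_cases h : p a <;> simp [h]
  | a :: b :: L, hp => by
    rw [List.isChain_cons_cons] at hp
    obtain ⟨h1, h2⟩ := alt_count hp.2
    have h3 := h2 b (by simp)
    by_cases h : p a
    · have hb : ¬ p b := hp.1.1 h
      have h3 := h3 hb
      simp only [List.filter_cons, h, hb, not_true_eq_false, not_false_eq_true, decide_true,
        decide_false, if_true, List.length_cons] at h1 h3 ⊢
      simp only [Bool.false_eq_true, if_false, List.length_cons] at h1 h3 ⊢
      refine ⟨by omega, fun c hc hc' => ?_⟩
      simp only [List.head?_cons, Option.mem_def, Option.some.injEq] at hc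
      exact absurd (hc ▸ h) hc'
    · have hb : p b := by
        by_contra hb
        exact h (hp.1.2 hb)
      simp only [List.filter_cons, h, hb, not_true_eq_false, not_false_eq_true, decide_true,
        decide_false, if_true, List.length_cons] at h1 ⊢
      simp only [Bool.false_eq_true, if_false, List.length_cons] at h1 ⊢
      refine ⟨by omega, fun _ _ _ => by omega⟩

theorem two_of_three {P Q R : Prop} (a1 : ¬ P ∨ ¬ Q) (a2 : ¬ Q ∨ ¬ R) (a3 : ¬ P ∨ ¬ R)
    (b1 : P ∨ Q) (b2 : Q ∨ R) (b3 : P ∨ R) : False := by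
  by_cases P <;> by_cases Q <;> by_cases R <;> simp_all

theorem main_step [Fintype V] {G : SimpleGraph V} (ht : Tough 3 G) (hfree : TwoK2Free G)
    (h4 : 4 ≤ Fintype.card V) {f : V → V} {L : List V} (hL : Cyc G L)
    (hf : ∀ v, v ∉ L → f v ∉ L ∧ f (f v) = v ∧ G.Adj v (f v))
    (hmax : MaxCyc G f L) {p q r : V} (hp : p ∈ L) (hq : q ∈ L) (hr : r ∈ L)
    (hpq : G.Adj p q) (hqr : G.Adj q r) (hpr : G.Adj p r) : ∀ x, x ∈ L := by
  classical
  by_contra hcon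
  push Not at hcon
  obtain ⟨x, hx⟩ := hcon
  have hch : ∀ {y}, y ∉ L → L.IsChain (fun a b => (Tch G f y a ↔ ¬ Tch G f y b)) :=
    fun hy => tch_chain ht hfree h4 hL hf hmax hy
  have hind : ∀ {y}, y ∉ L → ∀ a ∈ L, ∀ b ∈ L, G.Adj a b → Tch G f y a ∨ Tch G f y b := by
    intro y hy a ha b hb hab
    obtain ⟨g1, g2, g3⟩ := hf y hy
    have := twoK2 hfree hab g3 (fun e => hy (e ▸ ha)) (fun e => g1 (e ▸ ha))
      (fun e => hy (e ▸ hb)) (fun e => g1 (e ▸ hb))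
    unfold Tch
    tauto
  have hsame : ∀ {y}, y ∉ L → ∀ c ∈ L, (Tch G f x c ↔ Tch G f y c) := by
    intro y hy
    rcases alt_propagate (hch hx) (hch hy) with h | h
    · exact h
    · exfalso
      have a1 := hind hx p hp q hq hpq
      have a2 := hind hx q hq r hr hqr
      have a3 := hind hx p hp r hr hpr
      have b1 := hind hy p hp q hq hpq
      have b2 := hind hy q hq r hr hqr
      have b3 := hind hy p hp r hr hpr
      have c1 := h p hp
      have c2 := h q hq
      have c3 := h r hr
      rw [c1, c2] at a1
      rw [c2, c3] at a2
      rw [c1, c3] at a3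
      exact two_of_three a1 a2 a3 b1 b2 b3
  let Z : Finset V := (L.filter (fun c => ¬ Tch G f x c)).toFinset
  let A : Finset V := (L.filter (fun c => Tch G f x c)).toFinset
  have hZ : ∀ c, c ∈ Z ↔ c ∈ L ∧ ¬ Tch G f x c := by simp [Z]
  have hA : ∀ c, c ∈ A ↔ c ∈ L ∧ Tch G f x c := by simp [A]
  have hZc : Z.card = (L.filter (fun c => ¬ Tch G f x c)).length :=
    List.toFinset_card_of_nodup (hL.nodup.filter _)
  have hAc : A.card = (L.filter (fun c => Tch G f x c)).length :=
    List.toFinset_card_of_nodup (hL.nodup.filter _)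
  have hcount := (alt_count (hch hx)).1
  rw [← hZc, ← hAc] at hcount
  have hZne : Z.Nonempty := by
    have h3 := hL.three
    have hc := hch hx
    match L, h3, hc, hZ with
    | a :: b :: L, _, hc, hZ =>
      rw [List.isChain_cons_cons] at hc
      by_cases h : Tch G f x a
      · exact ⟨b, (hZ b).2 ⟨by simp, hc.1.1 h⟩⟩
      · exact ⟨a, (hZ a).2 ⟨by simp, h⟩⟩
  have hT := tough_T ht Z (by
    intro u hu v hv huv
    rw [hZ] at hu hv
    exact (hind hx u hu.1 v hv.1 huv).elim hu.2 hv.2) hZne h4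
  have hsub : nbr G Z ⊆ A := by
    intro w hw
    obtain ⟨z, hz, hzw⟩ := mem_nbr.1 hw
    rw [hZ] at hz
    have hwL : w ∈ L := by
      by_contra hw
      exact hz.2 ((hsame hw z hz.1).2 (Or.inl hzw))
    rw [hA]
    refine ⟨hwL, ?_⟩
    exact (hind hx z hz.1 w hwL hzw).resolve_left hz.2
  have := Finset.card_le_card hsub
  have := hZne.card_pos
  omega


theorem complete_ham [Fintype V] [DecidableEq V] (G : SimpleGraph V)
    (hc : ∀ v w, v ≠ w → G.Adj v w) (hcard : 3 ≤ Fintype.card V) : G.IsHamiltonian := by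
  have hlen : (Finset.univ : Finset V).toList.length = Fintype.card V := by
    rw [Finset.length_toList, Finset.card_univ]
  refine Cyc.hamiltonian (L := (Finset.univ : Finset V).toList) ?_ hlen
  have hnd := (Finset.univ : Finset V).nodup_toList
  generalize (Finset.univ : Finset V).toList = L at hlen hnd
  refine ⟨hnd, by omega, ?_, ?_⟩
  · exact List.Pairwise.isChain (hnd.imp fun {a b} h => hc a b h)
  · intro a ha b hb
    apply hc
    rintro rfl
    obtain ⟨L', rfl⟩ := List.head?_eq_some_iff.1 hb
    have hne : L' ≠ [] := by
      rintro rfl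
      simp at hlen
      omega
    have : a ∈ L' := by
      have e : a :: L' = [a] ++ L' := rfl
      rw [e, List.getLast?_append_of_ne_nil _ hne] at ha
      exact List.mem_of_getLast? ha
    exact (List.nodup_cons.1 hnd).1 this

theorem no_diamond_nbr [Fintype V] {G : SimpleGraph V} (ht : Tough 3 G) (hfree : TwoK2Free G)
    (h4 : 4 ≤ Fintype.card V)
    (hD : ∀ a b c d, G.Adj a b → G.Adj b c → G.Adj c d → G.Adj d a → G.Adj a c → b ≠ d → False)
    (x : V) : 4 * (nbr G {x}).card ≤ Fintype.card V + 4 := by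
  classical
  have hx : ∀ w, w ∈ nbr G {x} ↔ G.Adj x w := by
    intro w
    rw [mem_nbr]
    simp
  have path : ∀ a b c, G.Adj x a → G.Adj x b → G.Adj x c → G.Adj a b → G.Adj b c → a ≠ c → False :=
    fun a b c ha hb hc hab hbc hac => hD x a b c ha hab hbc hc.symm hb hac
  by_cases hi : ∀ u ∈ nbr G {x}, ∀ v ∈ nbr G {x}, ¬ G.Adj u v
  · have := indep_four ht _ hi h4
    omega
  · push Not at hi
    obtain ⟨y, hy, z, hz, hyz⟩ := hi
    have hi' : ∀ u ∈ (nbr G {x}).erase y, ∀ v ∈ (nbr G {x}).erase y, ¬ G.Adj u v := by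
      intro u hu v hv huv
      rw [Finset.mem_erase, hx] at hu hv
      rw [hx] at hy hz
      by_cases h1 : u = z
      · subst h1
        exact path y u v hy hu.2 hv.2 hyz huv hv.1.symm
      by_cases h2 : v = z
      · subst h2
        exact path y v u hy hv.2 hu.2 hyz huv.symm hu.1.symm
      rcases twoK2 hfree hyz huv hu.1.symm hv.1.symm (Ne.symm h1) (Ne.symm h2) with h | h | h | h
      · exact path z y u hz hy hu.2 hyz.symm h (Ne.symm h1)
      · exact path z y v hz hy hv.2 hyz.symm h (Ne.symm h2)
      · exact path y z u hy hz hu.2 hyz h hu.1.symm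
      · exact path y z v hy hz hv.2 hyz h hv.1.symm
    have := indep_four ht _ hi' h4
    rw [Finset.card_erase_of_mem hy] at this
    omega

theorem exists_diamond [Fintype V] {G : SimpleGraph V} (ht : Tough 3 G) (hfree : TwoK2Free G)
    (v w : V) (hvw : v ≠ w) (hn : ¬ G.Adj v w) :
    ∃ a b c d, G.Adj a b ∧ G.Adj b c ∧ G.Adj c d ∧ G.Adj d a ∧ G.Adj a c ∧ b ≠ d := by
  classical
  by_contra hcon
  have h6 := tough_deg ht v w hvw hn
  have h4 : 4 ≤ Fintype.card V := by
    have := Finset.card_le_univ (nbr G {v})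
    omega
  have key := no_diamond_nbr ht hfree h4
    (fun a b c d h1 h2 h3 h5 h7 h8 => hcon ⟨a, b, c, d, h1, h2, h3, h5, h7, h8⟩)
  obtain ⟨y, hy⟩ : (nbr G {v}).Nonempty := Finset.card_pos.1 (by omega)
  have hm : ∀ x w, w ∈ nbr G {x} ↔ G.Adj x w := by
    intro x w
    rw [mem_nbr]
    simp
  rw [hm] at hy
  have hZ := indep_four ht (nbr G {v} ∪ nbr G {y})ᶜ (by
    intro a ha b hb hab
    rw [Finset.mem_compl, Finset.mem_union, not_or, hm, hm] at ha hb
    rcases twoK2 hfree hy hab (by rintro rfl; exact ha.2 hy.symm) (by rintro rfl; exact hb.2 hy.symm)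
      (by rintro rfl; exact ha.1 hy) (by rintro rfl; exact hb.1 hy) with h | h | h | h
    · exact ha.1 h
    · exact hb.1 h
    · exact ha.2 h
    · exact hb.2 h) h4
  have h1 := Finset.card_add_card_compl (nbr G {v} ∪ nbr G {y})
  have h2 := Finset.card_union_le (nbr G {v}) (nbr G {y})
  have h3 := key v
  have h5 := key y
  omega

theorem ham_of_start [Fintype V] [DecidableEq V] {G : SimpleGraph V} (ht : Tough 3 G)
    (hfree : TwoK2Free G)
    (h4 : 4 ≤ Fintype.card V) {p q r : V} (hpq : G.Adj p q) (hqr : G.Adj q r) (hpr : G.Adj p r)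
    {L0 : List V} (hL0 : Cyc G L0) (hp : p ∈ L0) (hq : q ∈ L0) (hr : r ∈ L0)
    (hlen : L0.length ≤ 5) (hev : Even (Fintype.card V - L0.length)) : G.IsHamiltonian := by
  obtain ⟨f0, hf0⟩ := pm_exists ht L0.toFinset L0.toFinsetᶜ (by simp)
    (by rw [List.toFinset_card_of_nodup hL0.nodup]; exact hlen)
    (by rw [Finset.card_compl, List.toFinset_card_of_nodup hL0.nodup]; exact hev)
  obtain ⟨L, ⟨hL, hpL, hqL, hrL, f, hf⟩, hmax⟩ := exists_max_list
    (fun L => Cyc G L ∧ p ∈ L ∧ q ∈ L ∧ r ∈ L ∧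
      ∃ f : V → V, ∀ v, v ∉ L → f v ∉ L ∧ f (f v) = v ∧ G.Adj v (f v))
    ⟨L0, hL0, hp, hq, hr, f0, fun v hv => by
      have := hf0 v (by simpa using hv)
      simpa using this⟩ (fun L h => h.1.nodup)
  have hall := main_step ht hfree h4 hL hf (by
    intro L' h1 h2 h3
    refine hmax L' ⟨h1, h2 p hpL, h2 q hqL, h2 r hrL, f, fun v hv => ?_⟩
    have := hf v (fun h => hv (h2 v h))
    exact ⟨h3 v hv, this.2⟩) hpL hqL hrL hpq hqr hpr
  apply hL.hamiltonian
  rw [← List.toFinset_card_of_nodup hL.nodup, ← Finset.card_univ]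
  congr 1
  ext v
  simp [hall v]

theorem three_tough_twoK2Free_hamiltonian [Fintype V] [DecidableEq V] (G : SimpleGraph V)
    (htough : Tough 3 G) (hfree : TwoK2Free G) (hcard : 3 ≤ Fintype.card V) :
    G.IsHamiltonian := by
  by_cases hc : ∀ v w, v ≠ w → G.Adj v w
  · exact complete_ham G hc hcard
  push Not at hc
  obtain ⟨v, w, hvw, hn⟩ := hc
  have h6 := tough_deg htough v w hvw hn
  have h4 : 6 ≤ Fintype.card V := h6.trans (Finset.card_le_univ _)
  obtain ⟨a, b, c, d, hab, hbc, hcd, hda, hac, hbd⟩ := exists_diamond htough hfree v w hvw hn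
  rcases Nat.even_or_odd (Fintype.card V) with he | ho
  · refine ham_of_start htough hfree (by omega) hab hbc hac (L0 := [a, b, c, d]) ⟨?_, ?_, ?_, ?_⟩
      (by simp) (by simp) (by simp) (by simp) ?_
    · simp [hab.ne, hbc.ne, hcd.ne, hda.ne.symm, hac.ne, hbd]
    · simp
    · simp [hab, hbc, hcd]
    · simpa using hda
    · obtain ⟨k, hk⟩ := he
      refine ⟨k - 2, ?_⟩
      simp only [List.length_cons, List.length_nil]
      omega
  · refine ham_of_start htough hfree (by omega) hab hbc hac (L0 := [a, b, c]) ⟨?_, ?_, ?_, ?_⟩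
      (by simp) (by simp) (by simp) (by simp) ?_
    · simp [hab.ne, hbc.ne, hac.ne]
    · simp
    · simp [hab, hbc]
    · simpa using hac.symm
    · exact Nat.Odd.sub_odd ho ⟨1, rfl⟩
end

section
/- Let G be a 2K2-free graph with a minimum 2-factor F with at least two cycles, and let A be the set of A-type vertices. Then A⁺, the set of successors (along their respective cycles of F) of vertices in A, is an independent set in G. -/
open SimpleGraph

variable {V : Type*}

/-- `l` is a path (list with consecutive entries adjacent) from `a` to `b`. -/
def IsP (G : SimpleGraph V) (a b : V) (l : List V) : Prop :=
  l.IsChain G.Adj ∧ l.head? = some a ∧ l.getLast? = some b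

/-- `l` lists a cycle. -/
def Cyc_s8 (G : SimpleGraph V) (l : List V) : Prop :=
  3 ≤ l.length ∧ ∃ a b, IsP G a b l ∧ G.Adj b a

lemma IsP.append {G : SimpleGraph V} {a b p q : V} {l m : List V}
    (h1 : IsP G a b l) (h2 : IsP G p q m) (h : G.Adj b p) : IsP G a q (l ++ m) := by
  obtain ⟨c1, a1, b1⟩ := h1
  obtain ⟨c2, a2, b2⟩ := h2
  refine ⟨?_, ?_, ?_⟩
  · rw [List.isChain_append]
    refine ⟨c1, c2, ?_⟩
    intro x hx y hy
    rw [b1] at hx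
    rw [a2] at hy
    simp at hx hy
    subst hx hy
    exact h
  · simp [List.head?_append, a1]
  · simp [List.getLast?_append, b2]

lemma IsP.rev {G : SimpleGraph V} {a b : V} {l : List V}
    (h1 : IsP G a b l) : IsP G b a l.reverse := by
  obtain ⟨c1, a1, b1⟩ := h1
  refine ⟨?_, by simpa using b1, by simpa using a1⟩
  rw [List.isChain_reverse]
  exact c1.imp (fun _ _ h => h.symm)

lemma Cyc_s8.mk' {G : SimpleGraph V} {a b : V} {l : List V} (h : IsP G a b l) (hb : G.Adj b a)
    (hl : 3 ≤ l.length) : Cyc_s8 G l := ⟨hl, a, b, h, hb⟩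

/-- orient a path, both of whose ends are adjacent to `s` and one to `t`. -/
lemma orient_out {G : SimpleGraph V} {p q s t : V} {m : List V} (h : IsP G p q m)
    (sp : G.Adj s p) (sq : G.Adj s q) (ht : G.Adj t p ∨ G.Adj t q) :
    ∃ p' q' m', m'.Perm m ∧ IsP G p' q' m' ∧ G.Adj s p' ∧ G.Adj q' t := by
  rcases ht with ht | ht
  · exact ⟨q, p, _, List.reverse_perm m, h.rev, sq, ht.symm⟩
  · exact ⟨p, q, m, List.Perm.refl _, h, sp, ht.symm⟩

/-- orient a path, one end of which is adjacent to both `s` and `t`, the other to one. -/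
lemma orient_in {G : SimpleGraph V} {a b s t : V} {m : List V} (h : IsP G a b m)
    (bs : G.Adj b s) (bt : G.Adj b t) (ha : G.Adj a s ∨ G.Adj a t) :
    ∃ p' q' m', m'.Perm m ∧ IsP G p' q' m' ∧ G.Adj s p' ∧ G.Adj q' t := by
  rcases ha with ha | ha
  · exact ⟨a, b, m, List.Perm.refl _, h, ha.symm, bt⟩
  · exact ⟨b, a, _, List.reverse_perm m, h.rev, bs.symm, ha⟩

lemma cyc_fun {G : SimpleGraph V} {l : List V} (h : Cyc_s8 G l) (hn : l.Nodup) :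
    ∃ f : ZMod l.length → V, Function.Injective f ∧ (∀ j, G.Adj (f j) (f (j + 1))) ∧
      ∀ v, v ∈ l ↔ ∃ j, f j = v := by
  obtain ⟨h3, a, b, ⟨hc, ha, hb⟩, hba⟩ := h
  have : NeZero l.length := ⟨by omega⟩
  have : Fact (1 < l.length) := ⟨by omega⟩
  refine ⟨fun z => l[z.val]'(ZMod.val_lt z), ?_, ?_, ?_⟩
  · intro z w hzw
    exact ZMod.val_injective _ ((hn.getElem_inj_iff).1 hzw)
  · intro z
    have hz := ZMod.val_lt z
    by_cases hlt : z.val + 1 < l.length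
    · have e : (z + 1).val = z.val + 1 := by
        rw [ZMod.val_add_of_lt] <;> rw [ZMod.val_one]
        exact hlt
      simp only [e]
      exact (List.isChain_iff_getElem.1 hc) _ hlt
    · have e : (z + 1).val = 0 := by
        rw [ZMod.val_add, ZMod.val_one]
        have : z.val + 1 = l.length := by omega
        simp [this]
      have e2 : z.val = l.length - 1 := by omega
      simp only [e, e2]
      rw [List.head?_eq_getElem?] at ha
      rw [List.getLast?_eq_getElem?] at hb
      rw [List.getElem?_eq_some_iff] at ha hb
      obtain ⟨_, ha⟩ := ha
      obtain ⟨_, hb⟩ := hb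
      rw [ha, hb]
      exact hba
  · intro v
    constructor
    · intro hv
      obtain ⟨m, hm, rfl⟩ := List.getElem_of_mem hv
      refine ⟨(m : ZMod l.length), ?_⟩
      simp [ZMod.val_natCast_of_lt hm]
    · rintro ⟨j, rfl⟩
      exact List.getElem_mem _

lemma fam_of_list {G : SimpleGraph V} (L : List (List V)) (hc : ∀ l ∈ L, Cyc_s8 G l)
    (hn : L.flatten.Nodup) (hs : ∀ v, v ∈ L.flatten) :
    ∃ (n' : Fin L.length → ℕ) (c' : ∀ i, ZMod (n' i) → V), CycleFamily G L.length n' c' := by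
  rw [List.nodup_flatten] at hn
  have H : ∀ i : Fin L.length, ∃ f : ZMod (L[i]).length → V, Function.Injective f ∧
      (∀ j, G.Adj (f j) (f (j + 1))) ∧ ∀ v, v ∈ L[i] ↔ ∃ j, f j = v := fun i =>
    cyc_fun (hc _ (List.getElem_mem _)) (hn.1 _ (List.getElem_mem _))
  choose f hf1 hf2 hf3 using H
  refine ⟨fun i => (L[i]).length, f, ?_, hf1, hf2, ?_, ?_⟩
  · intro i
    exact (hc _ (List.getElem_mem _)).1
  · intro i i' j j' e
    have m1 : f i j ∈ L[i] := (hf3 i _).2 ⟨j, rfl⟩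
    have m2 : f i j ∈ L[i'] := (hf3 i' _).2 ⟨j', e.symm⟩
    have hp := List.pairwise_iff_getElem.1 hn.2
    rcases lt_trichotomy i.1 i'.1 with h | h | h
    · exact absurd m2 (hp i.1 i'.1 i.2 i'.2 h m1)
    · exact Fin.ext h
    · exact absurd m1 (hp i'.1 i.1 i'.2 i.2 h m2)
  · intro v
    obtain ⟨l, hl, hv⟩ := List.mem_flatten.1 (hs v)
    obtain ⟨m, hm, rfl⟩ := List.getElem_of_mem hl
    exact ⟨⟨m, hm⟩, (hf3 ⟨m, hm⟩ v).1 hv⟩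

/-- segment of a cycle -/
def seg {N : ℕ} (f : ZMod N → V) (s : ZMod N) (m : ℕ) : List V :=
  (List.range m).map (fun t : ℕ => f (s + t))

lemma seg_add {N : ℕ} (f : ZMod N → V) (s : ZMod N) (a b : ℕ) :
    seg f s (a + b) = seg f s a ++ seg f (s + a) b := by
  simp [seg, List.range_add, Function.comp_def, add_assoc]

lemma seg_isP {G : SimpleGraph V} {N : ℕ} (f : ZMod N → V) (hf : ∀ j, G.Adj (f j) (f (j + 1)))
    (s : ZMod N) (m : ℕ) : IsP G (f s) (f (s + m)) (seg f s (m + 1)) := by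
  induction m with
  | zero => simp [seg, IsP]
  | succ m ih =>
    rw [seg_add f s (m + 1) 1]
    refine ih.append (p := f (s + (m + 1 : ℕ))) (q := f (s + (m + 1 : ℕ))) ?_ ?_
    · simp [seg, IsP]
    · have := hf (s + m)
      push_cast
      rwa [← add_assoc]

/-- all of a cycle -/
def full {N : ℕ} (f : ZMod N → V) : List V := seg f 0 N

lemma seg_nodup {N : ℕ} (f : ZMod N → V) (hf : Function.Injective f) (s : ZMod N) :
    (seg f s N).Nodup := by
  refine List.Nodup.map_on ?_ List.nodup_range
  intro x hx y hy h
  have h' := hf h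
  have h2 : (x : ZMod N) = y := by simpa using h'
  simp at hx hy
  rw [ZMod.natCast_eq_natCast_iff'] at h2
  rwa [Nat.mod_eq_of_lt hx, Nat.mod_eq_of_lt hy] at h2

lemma seg_mem {N : ℕ} [NeZero N] (f : ZMod N → V) (s : ZMod N) (v : V) :
    v ∈ seg f s N ↔ ∃ j, f j = v := by
  simp only [seg, List.mem_map, List.mem_range]
  constructor
  · rintro ⟨a, _, h⟩
    exact ⟨_, h⟩
  · rintro ⟨j, rfl⟩
    exact ⟨(j - s).val, ZMod.val_lt _, by simp⟩

lemma seg_perm {N : ℕ} [NeZero N] (f : ZMod N → V) (hf : Function.Injective f) (s : ZMod N) :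
    (seg f s N).Perm (full f) := by
  rw [full, List.perm_ext_iff_of_nodup (seg_nodup f hf s) (seg_nodup f hf 0)]
  intro v
  rw [seg_mem, seg_mem]

lemma cyc_split {G : SimpleGraph V} {N : ℕ} (h3 : 3 ≤ N) (f : ZMod N → V)
    (hi : Function.Injective f) (hf : ∀ j, G.Adj (f j) (f (j + 1))) (j j' : ZMod N)
    (hj : j ≠ j') : ∃ l1 l2, IsP G (f (j + 1)) (f j') l1 ∧ IsP G (f (j' + 1)) (f j) l2 ∧
      (l1 ++ l2).Perm (full f) := by
  have : NeZero N := ⟨by omega⟩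
  set m := (j' - (j + 1)).val with hm
  have hmc : (m : ZMod N) = j' - (j + 1) := by simp [hm]
  have hmlt : m < N := ZMod.val_lt _
  have hne : m + 1 ≠ N := by
    intro h
    have : ((m + 1 : ℕ) : ZMod N) = 0 := by rw [h]; simp
    push_cast at this
    rw [hmc] at this
    apply hj
    have h5 : j' - j = 0 := by rw [← this]; ring
    exact (sub_eq_zero.1 h5).symm
  obtain ⟨r, hr⟩ : ∃ r, N = (m + 1) + (r + 1) := ⟨N - m - 2, by omega⟩
  have hrc : (((m + 1) + (r + 1) : ℕ) : ZMod N) = 0 := by rw [← hr]; simp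
  push_cast at hrc
  refine ⟨seg f (j + 1) (m + 1), seg f (j + 1 + (m + 1 : ℕ)) (r + 1), ?_, ?_, ?_⟩
  · have := seg_isP f hf (j + 1) m
    rwa [hmc, show j + 1 + (j' - (j + 1)) = j' by ring] at this
  · have := seg_isP f hf (j + 1 + (m + 1 : ℕ)) r
    have e1 : j + 1 + ((m + 1 : ℕ) : ZMod N) = j' + 1 := by push_cast; rw [hmc]; ring
    have e2 : j' + 1 + (r : ZMod N) = j := by
      rw [← e1]
      push_cast
      linear_combination hrc
    rw [e1, e2] at this
    rwa [e1]
  · rw [← seg_add]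
    have := seg_perm f hi (j + 1)
    have hh : seg f (j + 1) N = seg f (j + 1) (m + 1 + (r + 1)) := congrArg _ hr
    rwa [hh] at this

lemma cyc_open {G : SimpleGraph V} {N : ℕ} (h3 : 3 ≤ N) (f : ZMod N → V)
    (hi : Function.Injective f) (hf : ∀ j, G.Adj (f j) (f (j + 1))) (j : ZMod N) :
    ∃ l, IsP G (f (j + 1)) (f j) l ∧ l.Perm (full f) := by
  have : Fact (1 < N) := ⟨by omega⟩
  obtain ⟨l1, l2, h1, h2, h⟩ := cyc_split h3 f hi hf j (j + 1) (by simp)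
  exact ⟨_, h1.append h2 (hf _), h⟩

lemma repl {G : SimpleGraph V} {k : ℕ} {n : Fin k → ℕ} {c : ∀ i : Fin k, ZMod (n i) → V}
    (hF : CycleFamily G k n c)
    (hmin : ∀ (k' : ℕ) (n' : Fin k' → ℕ) (c' : ∀ i : Fin k', ZMod (n' i) → V),
      CycleFamily G k' n' c' → k ≤ k') (I : List (Fin k)) (hI : I.Nodup)
    (L : List (List V)) (hL : L.length < I.length) (hc : ∀ l ∈ L, Cyc_s8 G l)
    (hp : L.flatten.Perm (I.map fun i => full (c i)).flatten) : False := by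
  classical
  set J := (List.finRange k).filter (fun i => i ∉ I) with hJ
  have hIJ : (I ++ J).Perm (List.finRange k) := by
    rw [List.perm_ext_iff_of_nodup]
    · intro a
      simp [hJ]
      tauto
    · rw [List.nodup_append']
      refine ⟨hI, (List.nodup_finRange k).filter _, ?_⟩
      intro a ha hb
      simp [hJ] at hb
      exact hb ha
    · exact List.nodup_finRange k
  have hP : (L ++ J.map fun i => full (c i)).flatten.Perm
      ((List.finRange k).map fun i => full (c i)).flatten := by
    rw [List.flatten_append]
    refine (hp.append_right _).trans ?_
    rw [← List.flatten_append, ← List.map_append]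
    exact (hIJ.map _).flatten
  have hz : ∀ i, NeZero (n i) := fun i => ⟨by have := hF.three_le i; omega⟩
  obtain ⟨n', c', hF'⟩ := fam_of_list (G := G) (L ++ J.map fun i => full (c i)) (by
    intro l hl
    rcases List.mem_append.1 hl with hl | hl
    · exact hc l hl
    · obtain ⟨i, _, rfl⟩ := List.mem_map.1 hl
      have h3 := hF.three_le i
      refine ⟨by simpa [full, seg] using h3, c i 0, c i (0 + ((n i - 1 : ℕ) : ZMod (n i))), ?_, ?_⟩
      · have := seg_isP (c i) (hF.adj i) 0 (n i - 1)
        rwa [Nat.sub_add_cancel (by omega)] at this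
      · have := hF.adj i (0 + ((n i - 1 : ℕ) : ZMod (n i)))
        rwa [show (0 + ((n i - 1 : ℕ) : ZMod (n i))) + 1 = 0 by
          rw [Nat.cast_sub (by omega)]; simp] at this)
    (by
      rw [hP.nodup_iff, List.nodup_flatten]
      constructor
      · intro l hl
        obtain ⟨i, _, rfl⟩ := List.mem_map.1 hl
        exact seg_nodup _ (hF.inj i) 0
      · rw [List.pairwise_map]
        refine (List.nodup_finRange k).imp ?_
        intro i j hij v hv hv'
        have := hz i
        have := hz j
        obtain ⟨a, ha⟩ := (seg_mem _ _ _).1 hv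
        obtain ⟨b, hb⟩ := (seg_mem _ _ _).1 hv'
        exact hij (hF.disj i j a b (ha.trans hb.symm)))
    (by
      intro v
      rw [hP.mem_iff]
      obtain ⟨i, j, h⟩ := hF.spanning v
      have := hz i
      exact List.mem_flatten.2 ⟨full (c i), List.mem_map.2 ⟨i, List.mem_finRange i, rfl⟩,
        (seg_mem _ _ _).2 ⟨j, h⟩⟩)
  have h1 := hmin _ _ _ hF'
  have h2 := hIJ.length_eq
  simp at h1 h2
  omega

/-- A 2-factor with the minimum number of cycles. -/
structure MinFam (G : SimpleGraph V) (k : ℕ) (n : Fin k → ℕ)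
    (c : ∀ i : Fin k, ZMod (n i) → V) : Prop where
  fam : CycleFamily G k n c
  min : ∀ (k' : ℕ) (n' : Fin k' → ℕ) (c' : ∀ i : Fin k', ZMod (n' i) → V),
      CycleFamily G k' n' c' → k ≤ k'

section
variable {G : SimpleGraph V} {k : ℕ} {n : Fin k → ℕ} {c : ∀ i : Fin k, ZMod (n i) → V}

lemma MinFam.split (hM : MinFam G k n c) (i : Fin k) (j j' : ZMod (n i)) (hj : j ≠ j') :
    ∃ l1 l2, IsP G (c i (j + 1)) (c i j') l1 ∧ IsP G (c i (j' + 1)) (c i j) l2 ∧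
      (l1 ++ l2).Perm (full (c i)) ∧ 3 ≤ l1.length + l2.length := by
  obtain ⟨l1, l2, h1, h2, h⟩ :=
    cyc_split (hM.fam.three_le i) (c i) (hM.fam.inj i) (hM.fam.adj i) j j' hj
  refine ⟨l1, l2, h1, h2, h, ?_⟩
  have := h.length_eq
  have := hM.fam.three_le i
  simp [full, seg] at *
  omega

lemma MinFam.opn (hM : MinFam G k n c) (i : Fin k) (j : ZMod (n i)) :
    ∃ l, IsP G (c i (j + 1)) (c i j) l ∧ l.Perm (full (c i)) ∧ 3 ≤ l.length := by
  obtain ⟨l1, h1, h⟩ :=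
    cyc_open (hM.fam.three_le i) (c i) (hM.fam.inj i) (hM.fam.adj i) j
  refine ⟨l1, h1, h, ?_⟩
  have := h.length_eq
  have := hM.fam.three_le i
  simp [full, seg] at *
  omega

lemma MinFam.ne (hM : MinFam G k n c) {i i' : Fin k} (h : i ≠ i') (a : ZMod (n i))
    (b : ZMod (n i')) : c i a ≠ c i' b := fun e => h (hM.fam.disj _ _ _ _ e)

lemma k2 (h : TwoK2Free G) {a b p q : V} (hab : G.Adj a b) (hpq : G.Adj p q)
    (h1 : a ≠ p) (h2 : a ≠ q) (h3 : b ≠ p) (h4 : b ≠ q)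
    (n1 : ¬ G.Adj a p) (n2 : ¬ G.Adj a q) : G.Adj b p ∨ G.Adj b q := by
  by_contra hcon
  rw [not_or] at hcon
  exact h ⟨a, b, p, q, hab.ne, h1, h2, h3, h4, hpq.ne, hab, hpq, n1, n2, hcon.1, hcon.2⟩

lemma MinFam.merge1 (hM : MinFam G k n c) {i i' : Fin k} (h : i ≠ i') {a : ZMod (n i)}
    {b : ZMod (n i')} (h1 : G.Adj (c i a) (c i' b))
    (h2 : G.Adj (c i (a + 1)) (c i' (b + 1))) : False := by
  classical
  obtain ⟨l, hl, pl, sl⟩ := hM.opn i a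
  obtain ⟨m, hm, pm, sm⟩ := hM.opn i' b
  refine repl hM.fam hM.min [i, i'] (by simp [h]) [l ++ m.reverse] (by simp) ?_ ?_
  · simp only [List.mem_singleton, forall_eq]
    exact Cyc_s8.mk' (hl.append hm.rev h1) h2.symm (by simp; omega)
  · rw [List.perm_iff_count]
    intro v
    have := pl.count_eq v
    have := pm.count_eq v
    simp [List.count_append, List.count_reverse]
    omega

lemma MinFam.merge2 (hM : MinFam G k n c) {i i' : Fin k} (h : i ≠ i') {a : ZMod (n i)}
    {b : ZMod (n i')} (h1 : G.Adj (c i a) (c i' (b + 1)))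
    (h2 : G.Adj (c i (a + 1)) (c i' b)) : False := by
  classical
  obtain ⟨l, hl, pl, sl⟩ := hM.opn i a
  obtain ⟨m, hm, pm, sm⟩ := hM.opn i' b
  refine repl hM.fam hM.min [i, i'] (by simp [h]) [l ++ m] (by simp) ?_ ?_
  · simp only [List.mem_singleton, forall_eq]
    exact Cyc_s8.mk' (hl.append hm h1) h2.symm (by simp; omega)
  · rw [List.perm_iff_count]
    intro v
    have := pl.count_eq v
    have := pm.count_eq v
    simp [List.count_append]
    omega

/-- x and y on the same cycle -/
lemma MinFam.case1 (hM : MinFam G k n c) (hG : TwoK2Free G) {i d e : Fin k}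
    (hd : d ≠ i) (he : e ≠ i) {a b : ZMod (n i)} (hab : a ≠ b) {u : ZMod (n d)} {w : ZMod (n e)}
    (hxy : G.Adj (c i (a + 1)) (c i (b + 1)))
    (xu : G.Adj (c i a) (c d u)) (xu' : G.Adj (c i a) (c d (u + 1)))
    (yw : G.Adj (c i b) (c e w)) (yw' : G.Adj (c i b) (c e (w + 1))) : False := by
  classical
  have n1 : ¬ G.Adj (c i (a + 1)) (c d u) := fun h => hM.merge2 hd.symm xu' h
  have n2 : ¬ G.Adj (c i (a + 1)) (c d (u + 1)) := fun h => hM.merge1 hd.symm xu h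
  have n3 : ¬ G.Adj (c i (b + 1)) (c e w) := fun h => hM.merge2 he.symm yw' h
  have n4 : ¬ G.Adj (c i (b + 1)) (c e (w + 1)) := fun h => hM.merge1 he.symm yw h
  have hy := k2 hG hxy (hM.fam.adj d u) (hM.ne hd.symm _ _) (hM.ne hd.symm _ _)
    (hM.ne hd.symm _ _) (hM.ne hd.symm _ _) n1 n2
  have hx := k2 hG hxy.symm (hM.fam.adj e w) (hM.ne he.symm _ _) (hM.ne he.symm _ _)
    (hM.ne he.symm _ _) (hM.ne he.symm _ _) n3 n4
  obtain ⟨l1, l2, h1, h2, hp, hs⟩ := hM.split i a b hab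
  by_cases hde : d = e
  · subst hde
    by_cases huw : u = w
    · subst huw
      tauto
    · obtain ⟨m1, m2, g1, g2, gp, gs⟩ := hM.split d u w huw
      obtain ⟨p, q, l1', r1, s1, t1, t1'⟩ := orient_in h1 yw yw' hx
      obtain ⟨p', q', l2', r2, s2, t2, t2'⟩ := orient_in h2 xu xu' hy
      refine repl hM.fam hM.min [i, d] (by simp [hd.symm]) [m1 ++ l1' ++ m2 ++ l2'] (by simp) ?_ ?_
      · simp only [List.mem_singleton, forall_eq]
        exact Cyc_s8.mk' (((g1.append s1 t1).append g2 t1').append s2 t2) t2' (by simp; omega)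
      · rw [List.perm_iff_count]
        intro v
        have := hp.count_eq v
        have := gp.count_eq v
        have := r1.count_eq v
        have := r2.count_eq v
        simp [List.count_append] at *
        omega
  · obtain ⟨m, g, gp, gs⟩ := hM.opn d u
    obtain ⟨m', g', gp', gs'⟩ := hM.opn e w
    obtain ⟨p, q, l1', r1, s1, t1, t1'⟩ := orient_in h1 yw yw' hx
    obtain ⟨p', q', l2', r2, s2, t2, t2'⟩ := orient_in h2 xu xu' hy
    refine repl hM.fam hM.min [i, d, e] (by simp [hd.symm, he.symm, hde])
      [m ++ l2', m' ++ l1'] (by simp) ?_ ?_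
    · simp only [List.mem_cons, List.not_mem_nil, or_false, forall_eq_or_imp, forall_eq]
      exact ⟨Cyc_s8.mk' (g.append s2 t2) t2' (by simp; omega),
        Cyc_s8.mk' (g'.append s1 t1) t1' (by simp; omega)⟩
    · rw [List.perm_iff_count]
      intro v
      have := hp.count_eq v
      have := gp.count_eq v
      have := gp'.count_eq v
      have := r1.count_eq v
      have := r2.count_eq v
      simp [List.count_append] at *
      omega

lemma MinFam.ins2 (hM : MinFam G k n c) {i i' d : Fin k} (hi : i ≠ i')
    (hd : d ≠ i) {a w : ZMod (n i)} {b : ZMod (n i')} {u : ZMod (n d)}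
    (hxy : G.Adj (c i (a + 1)) (c i' (b + 1)))
    (xu : G.Adj (c i a) (c d u)) (xu' : G.Adj (c i a) (c d (u + 1)))
    (haw : a ≠ w) (yw : G.Adj (c i' b) (c i w))
    (hw : G.Adj (c i (w + 1)) (c d u) ∨ G.Adj (c i (w + 1)) (c d (u + 1))) : False := by
  classical
  obtain ⟨l1, l2, h1, h2, hp, hs⟩ := hM.split i a w haw
  obtain ⟨p', q', l2', r2, s2, t2, t2'⟩ := orient_in h2 xu xu' hw
  by_cases hdi : d = i'
  · subst hdi
    have hbu : b ≠ u := by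
      rintro rfl
      exact hM.merge1 hi xu hxy
    obtain ⟨m1, m2, g1, g2, gp, gs⟩ := hM.split d b u hbu
    refine repl hM.fam hM.min [i, d] (by simp [hd.symm]) [m1 ++ l2' ++ m2 ++ l1.reverse]
      (by simp) ?_ ?_
    · simp only [List.mem_singleton, forall_eq]
      exact Cyc_s8.mk' (((g1.append s2 t2).append g2 t2').append h1.rev yw) hxy (by simp; omega)
    · rw [List.perm_iff_count]
      intro v
      have := hp.count_eq v
      have := gp.count_eq v
      have := r2.count_eq v
      simp [List.count_append, List.count_reverse] at *
      omega
  · obtain ⟨m, g, gp, gs⟩ := hM.opn d u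
    obtain ⟨m', g', gp', gs'⟩ := hM.opn i' b
    refine repl hM.fam hM.min [i, d, i'] (by simp [hd.symm, hi, hdi])
      [m ++ l2', m' ++ l1.reverse] (by simp) ?_ ?_
    · simp only [List.mem_cons, List.not_mem_nil, or_false, forall_eq_or_imp, forall_eq]
      exact ⟨Cyc_s8.mk' (g.append s2 t2) t2' (by simp; omega),
        Cyc_s8.mk' (g'.append h1.rev yw) hxy (by simp; omega)⟩
    · rw [List.perm_iff_count]
      intro v
      have := hp.count_eq v
      have := gp.count_eq v
      have := gp'.count_eq v
      have := r2.count_eq v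
      simp [List.count_append, List.count_reverse] at *
      omega

/-- x on cycle `i`, y on cycle `i'`, y of A-type because of cycle `i` -/
lemma MinFam.case2 (hM : MinFam G k n c) (hG : TwoK2Free G) {i i' d : Fin k} (hi : i ≠ i')
    (hd : d ≠ i) {a w : ZMod (n i)} {b : ZMod (n i')} {u : ZMod (n d)}
    (hxy : G.Adj (c i (a + 1)) (c i' (b + 1)))
    (xu : G.Adj (c i a) (c d u)) (xu' : G.Adj (c i a) (c d (u + 1)))
    (yw : G.Adj (c i' b) (c i w)) (yw' : G.Adj (c i' b) (c i (w + 1))) : False := by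
  have nxy : ¬ G.Adj (c i' b) (c i a) := fun h => hM.merge1 hi h.symm hxy
  have haw : a ≠ w := by rintro rfl; exact nxy yw
  have haw' : a ≠ w + 1 := by rintro rfl; exact nxy yw'
  by_cases h : G.Adj (c i (w + 1)) (c d u) ∨ G.Adj (c i (w + 1)) (c d (u + 1))
  · exact hM.ins2 hi hd hxy xu xu' haw yw h
  · rw [not_or] at h
    exact hM.ins2 hi hd hxy xu xu' haw' yw' (k2 hG (hM.fam.adj i (w + 1)) (hM.fam.adj d u)
      (hM.ne hd.symm _ _) (hM.ne hd.symm _ _) (hM.ne hd.symm _ _) (hM.ne hd.symm _ _) h.1 h.2)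

/-- x on cycle `i`, y on cycle `i'`, both of A-type because of further cycles -/
lemma MinFam.case3 (hM : MinFam G k n c) (hG : TwoK2Free G) {i i' d e : Fin k} (hi : i ≠ i')
    (hd : d ≠ i) (hd' : d ≠ i') (he : e ≠ i) (he' : e ≠ i')
    {a : ZMod (n i)} {b : ZMod (n i')} {u : ZMod (n d)} {w : ZMod (n e)}
    (hxy : G.Adj (c i (a + 1)) (c i' (b + 1)))
    (xu : G.Adj (c i a) (c d u)) (xu' : G.Adj (c i a) (c d (u + 1)))
    (yw : G.Adj (c i' b) (c e w)) (yw' : G.Adj (c i' b) (c e (w + 1))) : False := by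
  classical
  have n1 : ¬ G.Adj (c i (a + 1)) (c d u) := fun h => hM.merge2 hd.symm xu' h
  have n2 : ¬ G.Adj (c i (a + 1)) (c d (u + 1)) := fun h => hM.merge1 hd.symm xu h
  have n3 : ¬ G.Adj (c i' (b + 1)) (c e w) := fun h => hM.merge2 he'.symm yw' h
  have n4 : ¬ G.Adj (c i' (b + 1)) (c e (w + 1)) := fun h => hM.merge1 he'.symm yw h
  have hy := k2 hG hxy (hM.fam.adj d u) (hM.ne hd.symm _ _) (hM.ne hd.symm _ _)
    (hM.ne hd'.symm _ _) (hM.ne hd'.symm _ _) n1 n2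
  have hx := k2 hG hxy.symm (hM.fam.adj e w) (hM.ne he'.symm _ _) (hM.ne he'.symm _ _)
    (hM.ne he.symm _ _) (hM.ne he.symm _ _) n3 n4
  obtain ⟨l, hl, pl, sl⟩ := hM.opn i a
  obtain ⟨q, hq, pq, sq⟩ := hM.opn i' b
  by_cases hde : d = e
  · subst hde
    have huw : u ≠ w := by
      rintro rfl
      tauto
    obtain ⟨m1, m2, g1, g2, gp, gs⟩ := hM.split d u w huw
    have key : ∀ L : List (List V), L.length < 3 → (∀ l ∈ L, Cyc_s8 G l) →
        (∀ v, L.flatten.count v = l.count v + q.count v + m1.count v + m2.count v) → False := by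
      intro L h1 h2 h3
      refine repl hM.fam hM.min [i, i', d] (by simp [hi, hd.symm, hd'.symm]) L (by simpa) h2 ?_
      rw [List.perm_iff_count]
      intro v
      have := h3 v
      have := pl.count_eq v
      have := pq.count_eq v
      have := gp.count_eq v
      simp [List.count_append] at *
      omega
    rcases hx with hx | hx <;> rcases hy with hy | hy
    · refine key [m1 ++ l, m2 ++ q] (by simp) ?_ ?_
      · simp only [List.mem_cons, List.not_mem_nil, or_false, forall_eq_or_imp, forall_eq]
        exact ⟨Cyc_s8.mk' (g1.append hl hx.symm) xu' (by simp; omega),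
          Cyc_s8.mk' (g2.append hq hy.symm) yw' (by simp; omega)⟩
      · intro v
        simp [List.count_append]
        omega
    · refine key [m1 ++ l ++ m2.reverse ++ q.reverse] (by simp) ?_ ?_
      · simp only [List.mem_singleton, forall_eq]
        exact Cyc_s8.mk' (((g1.append hl hx.symm).append g2.rev xu).append hq.rev yw'.symm) hy
          (by simp; omega)
      · intro v
        simp [List.count_append, List.count_reverse]
        omega
    · refine key [m1 ++ q.reverse ++ m2.reverse ++ l] (by simp) ?_ ?_
      · simp only [List.mem_singleton, forall_eq]
        exact Cyc_s8.mk' (((g1.append hq.rev yw.symm).append g2.rev hy).append hl hx.symm) xu'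
          (by simp; omega)
      · intro v
        simp [List.count_append, List.count_reverse]
        omega
    · refine key [m2 ++ l.reverse, m1 ++ q.reverse] (by simp) ?_ ?_
      · simp only [List.mem_cons, List.not_mem_nil, or_false, forall_eq_or_imp, forall_eq]
        exact ⟨Cyc_s8.mk' (g2.append hl.rev xu.symm) hx (by simp; omega),
          Cyc_s8.mk' (g1.append hq.rev yw.symm) hy (by simp; omega)⟩
      · intro v
        simp [List.count_append, List.count_reverse]
        omega
  · obtain ⟨m, g, gp, gs⟩ := hM.opn d u
    obtain ⟨m', g', gp', gs'⟩ := hM.opn e w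
    obtain ⟨_, _, l1', r1, s1, t1, t1'⟩ := orient_out g xu' xu hy.symm
    obtain ⟨_, _, l2', r2, s2, t2, t2'⟩ := orient_out g' yw' yw hx.symm
    refine repl hM.fam hM.min [i, i', d, e] (by simp [hi, hd.symm, hd'.symm, he.symm, he'.symm, hde])
      [l ++ l1' ++ q ++ l2'] (by simp) ?_ ?_
    · simp only [List.mem_singleton, forall_eq]
      exact Cyc_s8.mk' (((hl.append s1 t1).append hq t1').append s2 t2) t2' (by simp; omega)
    · rw [List.perm_iff_count]
      intro v
      have := pl.count_eq v
      have := pq.count_eq v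
      have := gp.count_eq v
      have := gp'.count_eq v
      have := r1.count_eq v
      have := r2.count_eq v
      simp [List.count_append] at *
      omega

end

theorem aplus_indep (G : SimpleGraph V) (h2k2 : TwoK2Free G)
    (k : ℕ) (n : Fin k → ℕ) (c : ∀ i : Fin k, ZMod (n i) → V)
    (hF : CycleFamily G k n c)
    (hmin : ∀ (k' : ℕ) (n' : Fin k' → ℕ) (c' : ∀ i : Fin k', ZMod (n' i) → V),
      CycleFamily G k' n' c' → k ≤ k')
    (hk : 2 ≤ k) :
    IndepSet G {v | ∃ (i : Fin k) (j : ZMod (n i)), AType G c i (c i j) ∧ v = c i (j + 1)} := by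
  rintro _ ⟨i, a, ⟨d, hd, u, xu, xu'⟩, rfl⟩ _ ⟨i', b, ⟨e, he, w, yw, yw'⟩, rfl⟩ hne hxy
  have hM : MinFam G k n c := ⟨hF, hmin⟩
  by_cases hi : i = i'
  · subst hi
    have hab : a ≠ b := by
      rintro rfl
      exact hne rfl
    exact hM.case1 h2k2 hd he hab hxy xu xu' yw yw'
  · by_cases h1 : e = i
    · subst h1
      exact hM.case2 h2k2 hi hd hxy xu xu' yw yw'
    · by_cases h2 : d = i'
      · subst h2
        exact hM.case2 h2k2 (Ne.symm hi) he hxy.symm yw yw' xu xu'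
      · exact hM.case3 h2k2 hi hd h2 h1 he hxy xu xu' yw yw'
end
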